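/- Let (X,d,m) be a length PI space having the deformation property and let E ⊆ X be a volume-constrained minimizer of the perimeter. Then E^(1) equals the topological interior of E^(1) and E^(0) equals the topological interior of E^(0); in particular E^(1) and E^(0) are open sets and the topological boundaries satisfy ∂E^(1) = ∂E^(0) = ∂^e E. -/

import Mathlib

open MeasureTheory Metric Set Filter Topology ENNReal Bornology
open scoped symmDiff

noncomputable section

variable {X : Type*}

/-- The slope (pointwise Lipschitz constant) of `f` at `x`, computed within `Ω`.
It vanishes at points that are isolated in `Ω`. -/
def slopeOn [MetricSpace X] (Ω : Set X) (f : X → ℝ) (x : X) : ℝ≥0∞ :=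
  Filter.limsup (fun y => ENNReal.ofReal (|f x - f y| / dist x y)) (𝓝[Ω \ {x}] x)

/-- The slope of `f`. -/
def mSlope [MetricSpace X] (f : X → ℝ) (x : X) : ℝ≥0∞ := slopeOn Set.univ f x

/-- `f` is locally Lipschitz on `Ω`. -/
def LocLipOn [MetricSpace X] (Ω : Set X) (f : X → ℝ) : Prop :=
  ∀ x ∈ Ω, ∃ r > (0:ℝ), ∃ K : NNReal, LipschitzOnWith K f (Metric.ball x r ∩ Ω)

/-- Convergence `fn → f` in `L¹_loc(Ω)` w.r.t. the measure `m`. -/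
def TendstoL1loc [MetricSpace X] [MeasurableSpace X] (m : Measure X) (Ω : Set X)
    (fn : ℕ → X → ℝ) (f : X → ℝ) : Prop :=
  ∀ K : Set X, K ⊆ Ω → IsCompact K →
    Tendsto (fun n => ∫⁻ x in K, ENNReal.ofReal |fn n x - f x| ∂m) atTop (𝓝 0)

/-- The total variation `|Df|(B)` of `f : X → ℝ` on the set `B`. -/
def totVar [MetricSpace X] [MeasurableSpace X] (m : Measure X) (f : X → ℝ) (B : Set X) : ℝ≥0∞ :=
  ⨅ (Ω : Set X) (_ : IsOpen Ω) (_ : B ⊆ Ω),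
    ⨅ (fn : ℕ → X → ℝ) (_ : ∀ n, LocLipOn Ω (fn n)) (_ : TendstoL1loc m Ω fn f),
      Filter.liminf (fun n => ∫⁻ x in Ω, slopeOn Ω (fn n) x ∂m) atTop

/-- The perimeter `P(E, B)` of a set `E` in `B`. -/
def Per [MetricSpace X] [MeasurableSpace X] (m : Measure X) (E B : Set X) : ℝ≥0∞ :=
  totVar m (Set.indicator E fun _ => (1:ℝ)) B

/-- `E` has locally finite perimeter. -/
def HasLocFinPer [MetricSpace X] [MeasurableSpace X] (m : Measure X) (E : Set X) : Prop :=
  ∀ x : X, ∃ r > (0:ℝ), Per m E (Metric.ball x r) < ∞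

/-- `E` has finite perimeter. -/
def HasFinPer [MetricSpace X] [MeasurableSpace X] (m : Measure X) (E : Set X) : Prop :=
  Per m E Set.univ < ∞

/-- `m` is finite on bounded sets. -/
def BoundedlyFinite [MetricSpace X] [MeasurableSpace X] (m : Measure X) : Prop :=
  ∀ B : Set X, Bornology.IsBounded B → m B < ∞

/-- Uniformly locally doubling with doubling function `C_D`. -/
def UnifLocDoublingWith [MetricSpace X] [MeasurableSpace X] (C_D : ℝ → ℝ) (m : Measure X) : Prop :=
  ∀ R : ℝ, 0 < R → ∀ x : X, ∀ r : ℝ, 0 < r → r < R →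
    m (Metric.ball x (2 * r)) ≤ ENNReal.ofReal (C_D R) * m (Metric.ball x r)

/-- Weak local (1,1)-Poincaré inequality with dilation `lam` and constant function `C_P`. -/
def WeakPoincareWith [MetricSpace X] [MeasurableSpace X] (lam : ℝ) (C_P : ℝ → ℝ)
    (m : Measure X) : Prop :=
  ∀ f : X → ℝ, LocLipOn Set.univ f → ∀ R : ℝ, 0 < R → ∀ x : X, ∀ r : ℝ, 0 < r → r < R →
    (∫⁻ y in Metric.ball x r,
        ENNReal.ofReal |f y - ⨍ z in Metric.ball x r, f z ∂m| ∂m) / m (Metric.ball x r)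
      ≤ ENNReal.ofReal (C_P R * r) *
          ((∫⁻ y in Metric.ball x (lam * r), mSlope f y ∂m) / m (Metric.ball x (lam * r)))

/-- `(X, d, m)` is a PI space. -/
def IsPIspace [MetricSpace X] [MeasurableSpace X] (m : Measure X) : Prop :=
  (∃ C_D : ℝ → ℝ, (∀ R, 0 < R → 0 < C_D R) ∧ UnifLocDoublingWith C_D m) ∧
  (∃ lam : ℝ, 1 ≤ lam ∧ ∃ C_P : ℝ → ℝ, (∀ R, 0 < R → 0 < C_P R) ∧ WeakPoincareWith lam C_P m)

/-- `(X, d)` is a length space: the distance between two points is the infimum of the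
lengths of continuous curves joining them. -/
def IsLengthSpace (X : Type*) [MetricSpace X] : Prop :=
  ∀ p q : X, ENNReal.ofReal (dist p q) =
    ⨅ (γ : ℝ → X) (_ : ContinuousOn γ (Set.Icc 0 1)) (_ : γ 0 = p) (_ : γ 1 = q),
      eVariationOn γ (Set.Icc 0 1)

/-- Essential interior `E^{(1)}`. -/
def essInt [MetricSpace X] [MeasurableSpace X] (m : Measure X) (E : Set X) : Set X :=
  { x | Tendsto (fun r : ℝ => m (E ∩ Metric.ball x r) / m (Metric.ball x r)) (𝓝[>] 0) (𝓝 1) }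

/-- Essential exterior `E^{(0)}`. -/
def essExt [MetricSpace X] [MeasurableSpace X] (m : Measure X) (E : Set X) : Set X :=
  { x | Tendsto (fun r : ℝ => m (E ∩ Metric.ball x r) / m (Metric.ball x r)) (𝓝[>] 0) (𝓝 0) }

/-- Essential boundary `∂^e E`. -/
def essBdry [MetricSpace X] [MeasurableSpace X] (m : Measure X) (E : Set X) : Set X :=
  (essInt m E ∪ essExt m E)ᶜ

/-- The two deformation inequalities hold for `E` at `x` with radius `R` and constant `C`. -/
def DeformIneq [MetricSpace X] [MeasurableSpace X] (m : Measure X) (E : Set X) (x : X)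
    (R C : ℝ) : Prop :=
  ∀ y ∈ Metric.ball x R, ∀ r ∈ Set.Ioo (0:ℝ) R,
    Per m (E \ Metric.ball y r) (Metric.ball x (2 * R)) ≤
      ENNReal.ofReal C * m (Metric.ball y r ∩ E) / ENNReal.ofReal r +
        Per m E (Metric.ball x (2 * R)) ∧
    Per m (E ∪ Metric.ball y r) (Metric.ball x (2 * R)) ≤
      ENNReal.ofReal C * m (Metric.ball y r \ E) / ENNReal.ofReal r +
        Per m E (Metric.ball x (2 * R))

/-- The deformation inequalities hold for `E` at `x` with radius `R` and some constant. -/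
def DeformAt [MetricSpace X] [MeasurableSpace X] (m : Measure X) (E : Set X) (x : X)
    (R : ℝ) : Prop :=
  0 < R ∧ R ≤ 1 ∧ ∃ C : ℝ, 0 ≤ C ∧ DeformIneq m E x R C

/-- `R_x(E)`: the maximal radius in `(0,1]` for which the deformation inequalities hold. -/
def deformRadius [MetricSpace X] [MeasurableSpace X] (m : Measure X) (E : Set X) (x : X) : ℝ :=
  sSup { R : ℝ | DeformAt m E x R }

/-- `(X, d, m)` has the deformation property. -/
def DeformationProperty [MetricSpace X] [MeasurableSpace X] (m : Measure X) : Prop :=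
  ∀ E : Set X, MeasurableSet E → HasLocFinPer m E → ∀ x : X, ∃ R : ℝ, DeformAt m E x R

/-- `E` is a volume-constrained minimizer of the perimeter. -/
def VolConstMin [MetricSpace X] [MeasurableSpace X] (m : Measure X) (E : Set X) : Prop :=
  MeasurableSet E ∧ HasLocFinPer m E ∧
    ∀ F K : Set X, MeasurableSet F → IsCompact K →
      m ((E ∆ F) \ K) = 0 → m (E ∩ K) = m (F ∩ K) → Per m E K ≤ Per m F K

/-- `E` is an isoperimetric set. -/
def IsIsoperimetricSet [MetricSpace X] [MeasurableSpace X] (m : Measure X) (E : Set X) : Prop :=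
  MeasurableSet E ∧ HasFinPer m E ∧ 0 < m E ∧ m E < ∞ ∧
    ∀ F : Set X, MeasurableSet F → m F = m E → Per m E Set.univ ≤ Per m F Set.univ

lemma limsup_add_le_of_ennreal {α : Type*} (l : Filter α) (u v : α → ℝ≥0∞) :
    limsup (fun a => u a + v a) l ≤ limsup u l + limsup v l := by
  refine ENNReal.le_of_forall_pos_le_add fun ε hε hfin => ?_
  have hε' : (0 : ℝ≥0∞) < (ε : ℝ≥0∞) / 2 := by simpa using hε.ne'
  have hu : limsup u l < limsup u l + (ε : ℝ≥0∞) / 2 :=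
    ENNReal.lt_add_right (ne_top_of_le_ne_top hfin.ne le_self_add) hε'.ne'
  have hv : limsup v l < limsup v l + (ε : ℝ≥0∞) / 2 :=
    ENNReal.lt_add_right (ne_top_of_le_ne_top hfin.ne le_add_self) hε'.ne'
  refine limsup_le_of_le (h := ?_)
  filter_upwards [eventually_lt_of_limsup_lt hu, eventually_lt_of_limsup_lt hv] with a h1 h2
  calc u a + v a ≤ (limsup u l + (ε : ℝ≥0∞) / 2) + (limsup v l + (ε : ℝ≥0∞) / 2) :=
        add_le_add h1.le h2.le
    _ = limsup u l + limsup v l + ((ε : ℝ≥0∞) / 2 + (ε : ℝ≥0∞) / 2) := by ring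
    _ = _ := by rw [ENNReal.add_halves]

lemma liminf_add_le_of_ennreal {α : Type*} (l : Filter α) (u v : α → ℝ≥0∞) :
    liminf u l + liminf v l ≤ liminf (fun a => u a + v a) l := by
  rcases eq_or_ne (liminf u l) 0 with hu | hu
  · rw [hu, zero_add]
    exact liminf_le_liminf (Eventually.of_forall fun a => le_add_self)
  rcases eq_or_ne (liminf v l) 0 with hv | hv
  · rw [hv, add_zero]
    exact liminf_le_liminf (Eventually.of_forall fun a => le_self_add)
  refine le_of_forall_lt_imp_le_of_dense fun c hc => ?_
  obtain ⟨a, ha, b, hb, hab⟩ := ENNReal.exists_lt_add_of_lt_add hc hu hv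
  refine le_liminf_of_le (h := ?_)
  filter_upwards [eventually_lt_of_lt_liminf ha, eventually_lt_of_lt_liminf hb] with x h1 h2
  exact hab.le.trans (add_le_add h1.le h2.le)

section Slope

variable [MetricSpace X]

lemma mSlope_def (f : X → ℝ) (x : X) :
    mSlope f x = limsup (fun y => ENNReal.ofReal (|f x - f y| / dist x y)) (𝓝[≠] x) := by
  rw [mSlope, slopeOn, compl_eq_univ_sdiff]

lemma slopeOn_eq_mSlope {Ω : Set X} (hΩ : IsOpen Ω) (f : X → ℝ) {x : X} (hx : x ∈ Ω) :
    slopeOn Ω f x = mSlope f x := by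
  rw [mSlope_def, slopeOn, sdiff_eq, inter_comm,
    nhdsWithin_inter_of_mem' (mem_nhdsWithin_of_mem_nhds (hΩ.mem_nhds hx))]

lemma mSlope_congr {f g : X → ℝ} {x : X} (h : f =ᶠ[𝓝 x] g) : mSlope f x = mSlope g x := by
  rw [mSlope_def, mSlope_def]
  refine limsup_congr ?_
  filter_upwards [mem_nhdsWithin_of_mem_nhds h] with y hy
  rw [h.self_of_nhds, show f y = g y from hy]

lemma mSlope_const (c : ℝ) (x : X) : mSlope (fun _ => c) x = 0 := by
  rw [mSlope_def]
  simp only [sub_self, abs_zero, zero_div, ENNReal.ofReal_zero]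
  exact le_antisymm (limsup_le_of_le (h := Eventually.of_forall fun _ => le_rfl)) bot_le

lemma mSlope_one_sub (f : X → ℝ) (x : X) : mSlope (fun y => 1 - f y) x = mSlope f x := by
  rw [mSlope_def, mSlope_def]
  congr 1
  ext y
  rw [show (1 - f x) - (1 - f y) = -(f x - f y) by ring, abs_neg]

/-- Slope of an interpolation `φ f + (1 - φ) g`. -/
lemma mSlope_interp {f g φ : X → ℝ} {x : X} {L : ℝ} (hL : 0 ≤ L)
    (hf : ContinuousAt f x) (hg : ContinuousAt g x) (hφ0 : 0 ≤ φ x) (hφ1 : φ x ≤ 1)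
    (hφ : ∀ᶠ y in 𝓝 x, |φ x - φ y| ≤ L * dist x y) :
    mSlope (fun y => φ y * f y + (1 - φ y) * g y) x ≤
      ENNReal.ofReal (φ x) * mSlope f x + ENNReal.ofReal (1 - φ x) * mSlope g x
        + ENNReal.ofReal (L * |f x - g x|) := by
  have key : ∀ᶠ y in 𝓝[≠] x,
      ENNReal.ofReal (|(φ x * f x + (1 - φ x) * g x) - (φ y * f y + (1 - φ y) * g y)| / dist x y)
      ≤ ENNReal.ofReal (φ x) * ENNReal.ofReal (|f x - f y| / dist x y)
        + ENNReal.ofReal (1 - φ x) * ENNReal.ofReal (|g x - g y| / dist x y)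
        + ENNReal.ofReal (L * |f y - g y|) := by
    filter_upwards [mem_nhdsWithin_of_mem_nhds hφ, self_mem_nhdsWithin] with y hy hne
    have hd : 0 < dist x y := dist_pos.2 (Ne.symm hne)
    rw [← ENNReal.ofReal_mul hφ0, ← ENNReal.ofReal_mul (by linarith),
      ← ENNReal.ofReal_add (by positivity) (mul_nonneg (by linarith) (by positivity)),
      ← ENNReal.ofReal_add (add_nonneg (by positivity) (mul_nonneg (by linarith) (by positivity)))
        (by positivity)]
    apply ENNReal.ofReal_le_ofReal
    rw [div_le_iff₀ hd]
    have e : (φ x * f x + (1 - φ x) * g x) - (φ y * f y + (1 - φ y) * g y)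
        = φ x * (f x - f y) + (1 - φ x) * (g x - g y) + (φ x - φ y) * (f y - g y) := by ring
    rw [e]
    calc _ ≤ |φ x * (f x - f y)| + |(1 - φ x) * (g x - g y)| + |(φ x - φ y) * (f y - g y)| :=
          abs_add_three _ _ _
      _ = φ x * |f x - f y| + (1 - φ x) * |g x - g y| + |φ x - φ y| * |f y - g y| := by
          rw [abs_mul, abs_mul, abs_mul, abs_of_nonneg hφ0, abs_of_nonneg (by linarith : 0 ≤ 1 - φ x)]
      _ ≤ φ x * |f x - f y| + (1 - φ x) * |g x - g y| + (L * dist x y) * |f y - g y| := by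
          gcongr
      _ = (φ x * (|f x - f y| / dist x y) + (1 - φ x) * (|g x - g y| / dist x y)
            + L * |f y - g y|) * dist x y := by field_simp
  have hA : ContinuousAt (fun y => ENNReal.ofReal (L * |f y - g y|)) x :=
    ENNReal.continuous_ofReal.continuousAt.comp
      (continuousAt_const.mul (hf.sub hg).abs)
  rw [mSlope_def (fun y => φ y * f y + (1 - φ y) * g y)]
  refine (limsup_le_limsup key).trans ?_
  have h3 : limsup (fun y => ENNReal.ofReal (L * |f y - g y|)) (𝓝[≠] x)
      ≤ ENNReal.ofReal (L * |f x - g x|) := by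
    rcases eq_or_neBot (𝓝[≠] x) with h | h
    · rw [h]; simp
    · exact (hA.tendsto.mono_left nhdsWithin_le_nhds).limsup_eq.le
  refine (limsup_add_le_of_ennreal _ _ _).trans (add_le_add ?_ h3)
  refine (limsup_add_le_of_ennreal _ _ _).trans (add_le_add ?_ ?_)
  · rw [mSlope_def, ENNReal.limsup_const_mul_of_ne_top ENNReal.ofReal_ne_top]
  · rw [mSlope_def, ENNReal.limsup_const_mul_of_ne_top ENNReal.ofReal_ne_top]

end Slope

/-- Lipschitz cutoff equal to `1` on `{u ≤ a}` and to `0` on `{u ≥ b}`. -/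
def cutoff (u : X → ℝ) (a b : ℝ) (x : X) : ℝ := max 0 (min 1 ((b - u x) / (b - a)))

lemma cutoff_nonneg (u : X → ℝ) (a b : ℝ) (x : X) : 0 ≤ cutoff u a b x := le_max_left _ _

lemma cutoff_le_one (u : X → ℝ) (a b : ℝ) (x : X) : cutoff u a b x ≤ 1 :=
  max_le zero_le_one (min_le_left _ _)

lemma cutoff_eq_one {u : X → ℝ} {a b : ℝ} (hab : a < b) {x : X} (hx : u x ≤ a) :
    cutoff u a b x = 1 := by
  have : 1 ≤ (b - u x) / (b - a) := by rw [le_div_iff₀ (by linarith)]; linarith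
  rw [cutoff, min_eq_left this, max_eq_right zero_le_one]

lemma cutoff_eq_zero {u : X → ℝ} {a b : ℝ} (hab : a < b) {x : X} (hx : b ≤ u x) :
    cutoff u a b x = 0 := by
  have : (b - u x) / (b - a) ≤ 0 := div_nonpos_of_nonpos_of_nonneg (by linarith) (by linarith)
  rw [cutoff, max_eq_left ((min_le_right _ _).trans this)]

section Energy

variable [MetricSpace X]

lemma mSlope_eq_iInf_iSup {Ω : Set X} (hΩ : IsOpen Ω) (f : X → ℝ) {x : X} (hx : x ∈ Ω) :
    mSlope f x = ⨅ n : ℕ, ⨆ y : X, ⨆ _ : y ∈ Ω ∧ y ≠ x ∧ dist y x < 1 / ((n : ℝ) + 1),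
      ENNReal.ofReal (|f x - f y| / dist x y) := by
  rw [← slopeOn_eq_mSlope hΩ f hx, slopeOn,
    (nhdsWithin_hasBasis nhds_basis_ball_inv_nat_succ _).limsup_eq_iInf_iSup]
  simp only [iInf_true]
  refine iInf_congr fun n => iSup_congr fun y => ?_
  refine iSup_congr_Prop ?_ fun _ => rfl
  simp only [mem_inter_iff, mem_ball, Set.mem_sdiff, mem_singleton_iff]
  tauto

lemma measurable_indicator_mSlope [MeasurableSpace X] [BorelSpace X] {Ω : Set X}
    (hΩ : IsOpen Ω) {f : X → ℝ} (hf : ContinuousOn f Ω) : Measurable (Ω.indicator (mSlope f)) := by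
  have e : Ω.indicator (mSlope f) = fun x => ⨅ n : ℕ, Ω.indicator (fun x =>
      ⨆ y : X, ⨆ _ : y ∈ Ω ∧ y ≠ x ∧ dist y x < 1 / ((n : ℝ) + 1),
      ENNReal.ofReal (|f x - f y| / dist x y)) x := by
    ext x
    by_cases hx : x ∈ Ω
    · simp only [indicator_of_mem hx]
      exact mSlope_eq_iInf_iSup hΩ f hx
    · simp [indicator_of_notMem hx]
  rw [e]
  refine Measurable.iInf fun n => LowerSemicontinuous.measurable ?_
  intro x c hc
  by_cases hx : x ∈ Ω
  swap
  · rw [indicator_of_notMem hx] at hc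
    exact absurd hc not_lt_bot
  rw [indicator_of_mem hx, gt_iff_lt, lt_iSup_iff] at hc
  obtain ⟨y, hc⟩ := hc
  rw [lt_iSup_iff] at hc
  obtain ⟨⟨hyΩ, hyx, hyd⟩, hc⟩ := hc
  have hfx : ContinuousAt f x := hf.continuousAt (hΩ.mem_nhds hx)
  have hq : ContinuousAt (fun z => ENNReal.ofReal (|f z - f y| / dist z y)) x :=
    ENNReal.continuous_ofReal.continuousAt.comp
      ((hfx.sub continuousAt_const).abs.div (continuousAt_id.dist continuousAt_const)
        (dist_pos.2 (Ne.symm hyx)).ne')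
  have h1 : ∀ᶠ z in 𝓝 x, y ≠ z := eventually_ne_nhds hyx.symm |>.mono fun z h => h.symm
  have h2 : ∀ᶠ z in 𝓝 x, dist y z < 1 / ((n : ℝ) + 1) :=
    (continuousAt_const.dist continuousAt_id).eventually_lt continuousAt_const hyd
  filter_upwards [hq.eventually (lt_mem_nhds hc), h1, h2, hΩ.mem_nhds hx] with z hz hz1 hz2 hz3
  rw [indicator_of_mem hz3, gt_iff_lt, lt_iSup_iff]
  refine ⟨y, ?_⟩
  rw [lt_iSup_iff]
  exact ⟨⟨hyΩ, hz1, hz2⟩, hz⟩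

/-- `f` is Lipschitz in a neighbourhood of `x`. -/
def LipAt (f : X → ℝ) (x : X) : Prop := ∃ K : NNReal, ∃ s ∈ 𝓝 x, LipschitzOnWith K f s

lemma LipAt.continuousAt {f : X → ℝ} {x : X} (h : LipAt f x) : ContinuousAt f x := by
  obtain ⟨K, s, hs, h⟩ := h
  exact h.continuousOn.continuousAt hs

lemma LipAt.congr {f g : X → ℝ} {x : X} (h : LipAt f x) (hfg : f =ᶠ[𝓝 x] g) : LipAt g x := by
  obtain ⟨K, s, hs, h⟩ := h
  refine ⟨K, s ∩ {y | f y = g y}, inter_mem hs hfg, ?_⟩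
  intro y hy z hz
  rw [← show f y = g y from hy.2, ← show f z = g z from hz.2]
  exact h hy.1 hz.1

lemma lipAt_const (c : ℝ) (x : X) : LipAt (fun _ => c) x :=
  ⟨0, univ, univ_mem, (LipschitzWith.const c).lipschitzOnWith⟩

lemma locLipOn_iff {Ω : Set X} (hΩ : IsOpen Ω) {f : X → ℝ} :
    LocLipOn Ω f ↔ ∀ x ∈ Ω, LipAt f x := by
  refine ⟨fun h x hx => ?_, fun h x hx => ?_⟩
  · obtain ⟨r, hr, K, hK⟩ := h x hx
    exact ⟨K, _, inter_mem (ball_mem_nhds x hr) (hΩ.mem_nhds hx), hK⟩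
  · obtain ⟨K, s, hs, hK⟩ := h x hx
    obtain ⟨r, hr, hrs⟩ := Metric.mem_nhds_iff.1 hs
    exact ⟨r, hr, K, hK.mono (inter_subset_left.trans hrs)⟩

lemma LocLipOn.continuousOn {Ω : Set X} (hΩ : IsOpen Ω) {f : X → ℝ} (h : LocLipOn Ω f) :
    ContinuousOn f Ω := fun x hx => ((locLipOn_iff hΩ).1 h x hx).continuousAt.continuousWithinAt

lemma LipAt.interp {f g φ : X → ℝ} {x : X} {L : NNReal} (hf : LipAt f x) (hg : LipAt g x)
    (hφ0 : ∀ y, 0 ≤ φ y) (hφ1 : ∀ y, φ y ≤ 1) (hφ : LipschitzWith L φ) :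
    LipAt (fun y => φ y * f y + (1 - φ y) * g y) x := by
  have hcont : ContinuousAt (fun y => |f y - g y|) x := (hf.continuousAt.sub hg.continuousAt).abs
  obtain ⟨K, s, hs, hK⟩ := hf
  obtain ⟨K', s', hs', hK'⟩ := hg
  set M : NNReal := ⟨|f x - g x| + 1, by positivity⟩ with hM
  have hb : ∀ᶠ y in 𝓝 x, |f y - g y| < M :=
    hcont.eventually (gt_mem_nhds (show |f x - g x| < |f x - g x| + 1 by linarith))
  refine ⟨K + K' + L * M, s ∩ s' ∩ {y | |f y - g y| < M}, inter_mem (inter_mem hs hs') hb, ?_⟩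
  refine LipschitzOnWith.of_dist_le_mul fun y hy z hz => ?_
  have h1 := hK.dist_le_mul y hy.1.1 z hz.1.1
  have h2 := hK'.dist_le_mul y hy.1.2 z hz.1.2
  have h3 := hφ.dist_le_mul y z
  rw [Real.dist_eq] at h1 h2 h3 ⊢
  have e : (φ y * f y + (1 - φ y) * g y) - (φ z * f z + (1 - φ z) * g z)
        = φ y * (f y - f z) + (1 - φ y) * (g y - g z) + (φ y - φ z) * (f z - g z) := by ring
  rw [e]
  have hz2 : |f z - g z| ≤ M := le_of_lt hz.2
  have hd : 0 ≤ dist y z := dist_nonneg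
  calc _ ≤ |φ y * (f y - f z)| + |(1 - φ y) * (g y - g z)| + |(φ y - φ z) * (f z - g z)| :=
        abs_add_three _ _ _
    _ = φ y * |f y - f z| + (1 - φ y) * |g y - g z| + |φ y - φ z| * |f z - g z| := by
        rw [abs_mul, abs_mul, abs_mul, abs_of_nonneg (hφ0 y),
          abs_of_nonneg (by linarith [hφ1 y] : 0 ≤ 1 - φ y)]
    _ ≤ 1 * (K * dist y z) + 1 * (K' * dist y z) + (L * dist y z) * M := by
        gcongr
        · exact hφ1 y
        · linarith [hφ0 y]
    _ = _ := by push_cast; ring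

lemma cutoff_lipschitz {u : X → ℝ} (hu : LipschitzWith 1 u) {a b : ℝ} (hab : a < b) :
    LipschitzWith (Real.toNNReal (1 / (b - a))) (cutoff u a b) := by
  have h : LipschitzWith (Real.toNNReal (1 / (b - a))) (fun x => (b - u x) / (b - a)) := by
    refine LipschitzWith.of_dist_le_mul fun x y => ?_
    have hp : 0 < b - a := by linarith
    rw [Real.coe_toNNReal _ (by positivity), Real.dist_eq,
      show (b - u x) / (b - a) - (b - u y) / (b - a) = (u y - u x) / (b - a) by ring,
      abs_div, abs_of_pos hp, one_div, inv_mul_eq_div]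
    have := hu.dist_le_mul y x
    rw [Real.dist_eq, NNReal.coe_one, one_mul, dist_comm] at this
    gcongr
  exact (h.const_min 1).const_max 0

lemma lipschitzWith_one_dist (p : X) : LipschitzWith 1 (fun x => dist x p) :=
  LipschitzWith.dist_left p

variable [MeasurableSpace X] {m : Measure X}

lemma totVar_le_of_seq {Ω B : Set X} (hΩ : IsOpen Ω) (hB : B ⊆ Ω) {f : X → ℝ} {fn : ℕ → X → ℝ}
    (h1 : ∀ n, ∀ x ∈ Ω, LipAt (fn n) x) (h2 : TendstoL1loc m Ω fn f) (hΩm : MeasurableSet Ω) :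
    totVar m f B ≤ liminf (fun n => ∫⁻ x in Ω, mSlope (fn n) x ∂m) atTop := by
  unfold totVar
  refine iInf₂_le_of_le Ω hΩ (iInf₂_le_of_le hB fn (iInf₂_le_of_le
    (fun n => (locLipOn_iff hΩ).2 (h1 n)) h2 (le_of_eq ?_)))
  congr 1
  ext n
  exact setLIntegral_congr_fun hΩm fun x hx => slopeOn_eq_mSlope hΩ _ hx

lemma TendstoL1loc.mono {Ω Ω' : Set X} (h : Ω' ⊆ Ω) {fn : ℕ → X → ℝ} {f : X → ℝ}
    (hf : TendstoL1loc m Ω fn f) : TendstoL1loc m Ω' fn f :=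
  fun K hK hKc => hf K (hK.trans h) hKc

lemma TendstoL1loc.comp {Ω : Set X} {fn : ℕ → X → ℝ} {f : X → ℝ}
    (hf : TendstoL1loc m Ω fn f) {k : ℕ → ℕ} (hk : Tendsto k atTop atTop) :
    TendstoL1loc m Ω (fun n => fn (k n)) f :=
  fun K hK hKc => (hf K hK hKc).comp hk

lemma exists_seq_of_totVar_lt [BorelSpace X] {B : Set X} {f : X → ℝ} {c : ℝ≥0∞}
    (h : totVar m f B < c) : ∃ Ω, IsOpen Ω ∧ B ⊆ Ω ∧ ∃ fn : ℕ → X → ℝ,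
      (∀ n, ∀ x ∈ Ω, LipAt (fn n) x) ∧ TendstoL1loc m Ω fn f ∧
        ∀ n, ∫⁻ x in Ω, mSlope (fn n) x ∂m < c := by
  simp only [totVar, iInf_lt_iff] at h
  obtain ⟨Ω, hΩ, hB, fn, h1, h2, h3⟩ := h
  obtain ⟨k, hk, hk'⟩ := extraction_of_frequently_atTop (frequently_lt_of_liminf_lt (h := h3))
  refine ⟨Ω, hΩ, hB, fun n => fn (k n), fun n => (locLipOn_iff hΩ).1 (h1 _),
    h2.comp hk.tendsto_atTop, fun n => (le_of_eq ?_).trans_lt (hk' n)⟩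
  exact (setLIntegral_congr_fun hΩ.measurableSet fun x hx => slopeOn_eq_mSlope hΩ _ hx).symm

lemma exists_seq_of_totVar_open_lt [BorelSpace X] {Ω : Set X} {f : X → ℝ} {c : ℝ≥0∞}
    (h : totVar m f Ω < c) : ∃ fn : ℕ → X → ℝ,
      (∀ n, ∀ x ∈ Ω, LipAt (fn n) x) ∧ TendstoL1loc m Ω fn f ∧
        ∀ n, ∫⁻ x in Ω, mSlope (fn n) x ∂m < c := by
  obtain ⟨Ω', -, hB, fn, h1, h2, h3⟩ := exists_seq_of_totVar_lt h
  exact ⟨fn, fun n x hx => h1 n x (hB hx), h2.mono hB,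
    fun n => (lintegral_mono_set hB).trans_lt (h3 n)⟩

lemma totVar_mono {f : X → ℝ} {A B : Set X} (h : A ⊆ B) : totVar m f A ≤ totVar m f B := by
  refine le_iInf fun Ω => le_iInf fun hΩ => le_iInf fun hB => ?_
  exact iInf_le_of_le Ω <| iInf_le_of_le hΩ <| iInf_le_of_le (h.trans hB) le_rfl

lemma totVar_congr_open {f g : X → ℝ} {Ω : Set X} (hΩ : IsOpen Ω) [BorelSpace X]
    (h : ∀ x ∈ Ω, f x = g x) : totVar m f Ω ≤ totVar m g Ω := by
  refine le_of_forall_gt fun c hc => ?_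
  obtain ⟨c', hc', hc''⟩ := exists_between hc
  obtain ⟨fn, h1, h2, h3⟩ := exists_seq_of_totVar_open_lt hc'
  refine (totVar_le_of_seq hΩ subset_rfl h1 ?_ hΩ.measurableSet).trans_lt
    ((liminf_le_of_le (h := fun b hb => ?_)).trans_lt hc'')
  · intro K hK hKc
    refine (h2 K hK hKc).congr fun n => ?_
    exact setLIntegral_congr_fun hKc.measurableSet fun x hx => by simp only [h x (hK hx)]
  · obtain ⟨n, hn⟩ := hb.exists
    exact hn.trans (h3 n).le

lemma totVar_one_sub_le [BorelSpace X] (f : X → ℝ) (B : Set X) :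
    totVar m (fun x => 1 - f x) B ≤ totVar m f B := by
  refine le_of_forall_gt fun c hc => ?_
  obtain ⟨c', hc', hc''⟩ := exists_between hc
  obtain ⟨Ω, hΩ, hB, fn, h1, h2, h3⟩ := exists_seq_of_totVar_lt hc'
  refine (totVar_le_of_seq (fn := fun n x => 1 - fn n x) hΩ hB ?_ ?_ hΩ.measurableSet).trans_lt
    ((liminf_le_of_le (h := fun b hb => ?_)).trans_lt hc'')
  · intro n x hx
    obtain ⟨K, s, hs, hK⟩ := h1 n x hx
    refine ⟨K, s, hs, LipschitzOnWith.of_dist_le_mul fun y hy z hz => ?_⟩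
    have := hK.dist_le_mul y hy z hz
    rw [Real.dist_eq] at this ⊢
    rwa [show (1 - fn n y) - (1 - fn n z) = -(fn n y - fn n z) by ring, abs_neg]
  · intro K hK hKc
    refine (h2 K hK hKc).congr fun n => ?_
    refine lintegral_congr fun x => ?_
    rw [show (1 - fn n x) - (1 - f x) = -(fn n x - f x) by ring, abs_neg]
  · obtain ⟨n, hn⟩ := hb.exists
    refine hn.trans ((lintegral_congr fun x => ?_).trans_le (h3 n).le)
    exact mSlope_one_sub _ _

lemma Per_compl [BorelSpace X] (E B : Set X) : Per m Eᶜ B = Per m E B := by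
  have h : ∀ F : Set X, Per m Fᶜ B ≤ Per m F B := fun F => by
    have e : (Fᶜ.indicator fun _ => (1 : ℝ)) = fun x => 1 - F.indicator (fun _ => (1 : ℝ)) x := by
      ext x
      by_cases hx : x ∈ F <;> simp [hx]
    rw [Per, e]
    exact totVar_one_sub_le _ _
  exact le_antisymm (h E) (by simpa using h Eᶜ)

lemma Per_congr_open [BorelSpace X] {E F Ω : Set X} (hΩ : IsOpen Ω)
    (h : ∀ x ∈ Ω, x ∈ E ↔ x ∈ F) : Per m E Ω = Per m F Ω := by
  have e : ∀ x ∈ Ω, E.indicator (fun _ => (1 : ℝ)) x = F.indicator (fun _ => (1 : ℝ)) x := by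
    intro x hx
    by_cases hE : x ∈ E
    · rw [indicator_of_mem hE, indicator_of_mem ((h x hx).1 hE)]
    · rw [indicator_of_notMem hE, indicator_of_notMem (mt (h x hx).2 hE)]
  exact le_antisymm (totVar_congr_open hΩ e) (totVar_congr_open hΩ fun x hx => (e x hx).symm)

/-- Superadditivity of the total variation on disjoint open sets. -/
lemma totVar_add_le_of_disjoint [BorelSpace X] {f : X → ℝ} {A B V : Set X} (hA : IsOpen A)
    (hB : IsOpen B) (hAB : Disjoint A B) (hAV : A ⊆ V) (hBV : B ⊆ V) :
    totVar m f A + totVar m f B ≤ totVar m f V := by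
  refine le_of_forall_gt fun c hc => ?_
  obtain ⟨c', hc', hc''⟩ := exists_between hc
  obtain ⟨fn, h1, h2, h3⟩ := exists_seq_of_totVar_open_lt hc'
  have hA' := totVar_le_of_seq hA subset_rfl (fun n x hx => h1 n x (hAV hx)) (h2.mono hAV)
    hA.measurableSet
  have hB' := totVar_le_of_seq hB subset_rfl (fun n x hx => h1 n x (hBV hx)) (h2.mono hBV)
    hB.measurableSet
  refine (add_le_add hA' hB').trans_lt ?_
  refine (liminf_add_le_of_ennreal _ _ _).trans_lt
    ((liminf_le_of_le (h := fun b hb => ?_)).trans_lt hc'')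
  obtain ⟨n, hn⟩ := hb.exists
  refine hn.trans (le_trans ?_ (h3 n).le)
  rw [← lintegral_union hB.measurableSet hAB]
  exact lintegral_mono_set (union_subset hAV hBV)

end Energy

section Glue

variable [MetricSpace X]

lemma mSlope_glue_le {f g u : X → ℝ} {a b : ℝ} (hu : LipschitzWith 1 u) (hab : a < b)
    {A₁ A₂ T : Set X} {x : X} (hf : x ∈ A₁ → LipAt f x) (hg : x ∈ A₂ → LipAt g x)
    (h1 : u x ≤ b → x ∈ A₁) (h2 : a ≤ u x → x ∈ A₂) (hT : a ≤ u x → u x ≤ b → x ∈ T) :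
    LipAt (fun y => cutoff u a b y * f y + (1 - cutoff u a b y) * g y) x ∧
    mSlope (fun y => cutoff u a b y * f y + (1 - cutoff u a b y) * g y) x ≤
      A₁.indicator (mSlope f) x + A₂.indicator (mSlope g) x +
        T.indicator (fun y => ENNReal.ofReal (1 / (b - a) * |f y - g y|)) x := by
  have hba : 0 ≤ 1 / (b - a) := by
    have : 0 < b - a := by linarith
    positivity
  rcases lt_or_ge (u x) a with h | h
  · have e : f =ᶠ[𝓝 x] (fun y => cutoff u a b y * f y + (1 - cutoff u a b y) * g y) := by
      filter_upwards [hu.continuous.continuousAt.eventually (gt_mem_nhds h)] with y hy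
      rw [cutoff_eq_one hab hy.le]
      ring
    have hx := h1 (by linarith)
    refine ⟨(hf hx).congr e, ?_⟩
    rw [← mSlope_congr e, indicator_of_mem hx, add_assoc]
    exact le_self_add
  rcases lt_or_ge b (u x) with h' | h'
  · have e : g =ᶠ[𝓝 x] (fun y => cutoff u a b y * f y + (1 - cutoff u a b y) * g y) := by
      filter_upwards [hu.continuous.continuousAt.eventually (lt_mem_nhds h')] with y hy
      rw [cutoff_eq_zero hab hy.le]
      ring
    have hx := h2 (by linarith)
    refine ⟨(hg hx).congr e, ?_⟩
    rw [← mSlope_congr e, indicator_of_mem hx, add_comm (A₁.indicator _ _), add_assoc]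
    exact le_self_add
  · refine ⟨(hf (h1 h')).interp (hg (h2 h)) (cutoff_nonneg _ _ _) (cutoff_le_one _ _ _)
      (cutoff_lipschitz hu hab), ?_⟩
    rw [indicator_of_mem (h1 h'), indicator_of_mem (h2 h), indicator_of_mem (hT h h')]
    refine (mSlope_interp hba (hf (h1 h')).continuousAt (hg (h2 h)).continuousAt
      (cutoff_nonneg _ _ _ _) (cutoff_le_one _ _ _ _) (Eventually.of_forall fun y => ?_)).trans ?_
    · have := (cutoff_lipschitz hu hab).dist_le_mul x y
      rwa [Real.dist_eq, Real.coe_toNNReal _ hba] at this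
    · gcongr
      · exact mul_le_of_le_one_left' (ENNReal.ofReal_le_one.2 (cutoff_le_one _ _ _ _))
      · exact mul_le_of_le_one_left'
          (ENNReal.ofReal_le_one.2 (by linarith [cutoff_nonneg u a b x]))

variable [MeasurableSpace X] [BorelSpace X] {m : Measure X}

lemma aemeasurable_ofReal_abs_sub {A K : Set X} {f F : X → ℝ} (hf : ∀ x ∈ A, LipAt f x)
    (hF : Measurable F) (hKA : K ⊆ A) (hK : MeasurableSet K) :
    AEMeasurable (fun x => ENNReal.ofReal |f x - F x|) (m.restrict K) := by
  have h : ContinuousOn f K := fun x hx => (hf x (hKA hx)).continuousAt.continuousWithinAt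
  have := (h.aemeasurable hK (μ := m)).sub hF.aemeasurable
  exact (continuous_abs.measurable.comp_aemeasurable this).ennreal_ofReal

/-- Subadditivity of the total variation for overlapping open sets. -/
lemma totVar_glue {F u : X → ℝ} (hF : Measurable F) {a b : ℝ} (hu : LipschitzWith 1 u)
    (hab : a < b) {V A₁ A₂ T : Set X} (hV : IsOpen V) (hA₁ : IsOpen A₁) (hA₂ : IsOpen A₂)
    (hT : IsCompact T) (h1 : ∀ x ∈ V, u x ≤ b → x ∈ A₁) (h2 : ∀ x ∈ V, a ≤ u x → x ∈ A₂)
    (h3 : ∀ x ∈ V, a ≤ u x → u x ≤ b → x ∈ T) (hT1 : T ⊆ A₁) (hT2 : T ⊆ A₂) :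
    totVar m F V ≤ totVar m F A₁ + totVar m F A₂ := by
  refine ENNReal.le_of_forall_pos_le_add fun ε hε hfin => ?_
  have hε' : (ε : ℝ≥0∞) / 3 ≠ 0 := by simpa using hε.ne'
  have hε3 : (ε : ℝ≥0∞) / 3 + ε / 3 + ε / 3 = ε := ENNReal.add_thirds _
  obtain ⟨f, f1, f2, f3⟩ := exists_seq_of_totVar_open_lt
    (ENNReal.lt_add_right (ne_top_of_le_ne_top hfin.ne le_self_add) hε' :
      totVar m F A₁ < totVar m F A₁ + ε / 3)
  obtain ⟨g, g1, g2, g3⟩ := exists_seq_of_totVar_open_lt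
    (ENNReal.lt_add_right (ne_top_of_le_ne_top hfin.ne le_add_self) hε' :
      totVar m F A₂ < totVar m F A₂ + ε / 3)
  set φ := cutoff u a b with hφ
  have key := fun n x (hx : x ∈ V) => mSlope_glue_le hu hab (f1 n x) (g1 n x) (h1 x hx) (h2 x hx)
    (h3 x hx)
  have hlip : ∀ n, ∀ x ∈ V, LipAt (fun y => φ y * f n y + (1 - φ y) * g n y) x :=
    fun n x hx => (key n x hx).1
  have hconv : TendstoL1loc m V (fun n y => φ y * f n y + (1 - φ y) * g n y) F := by
    intro K hKV hK
    have hK1 : IsCompact (K ∩ {x | u x ≤ b}) :=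
      hK.inter_right (isClosed_le hu.continuous continuous_const)
    have hK2 : IsCompact (K ∩ {x | a ≤ u x}) :=
      hK.inter_right (isClosed_le continuous_const hu.continuous)
    have hs1 : K ∩ {x | u x ≤ b} ⊆ A₁ := fun x hx => h1 x (hKV hx.1) hx.2
    have hs2 : K ∩ {x | a ≤ u x} ⊆ A₂ := fun x hx => h2 x (hKV hx.1) hx.2
    have hlim := (f2 _ hs1 hK1).add (g2 _ hs2 hK2)
    rw [add_zero] at hlim
    refine tendsto_of_tendsto_of_tendsto_of_le_of_le tendsto_const_nhds hlim
      (fun n => zero_le) fun n => ?_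
    simp only
    rw [← lintegral_indicator hK.measurableSet, ← lintegral_indicator hK1.measurableSet,
      ← lintegral_indicator hK2.measurableSet, ← lintegral_add_left'
        ((aemeasurable_indicator_iff hK1.measurableSet).2
        (aemeasurable_ofReal_abs_sub (f1 n) hF hs1 hK1.measurableSet))]
    refine lintegral_mono fun x => ?_
    by_cases hx : x ∈ K
    swap
    · simp [indicator_of_notMem hx]
    rw [indicator_of_mem hx]
    have c0 : 0 ≤ φ x := cutoff_nonneg _ _ _ _
    have c1 : φ x ≤ 1 := cutoff_le_one _ _ _ _
    rcases lt_or_ge (u x) a with h | h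
    · have e : φ x = 1 := cutoff_eq_one hab h.le
      rw [indicator_of_mem (s := K ∩ {x | u x ≤ b}) ⟨hx, by simp only [mem_ofPred_eq]; linarith⟩, e]
      simp
    rcases lt_or_ge b (u x) with h' | h'
    · have e : φ x = 0 := cutoff_eq_zero hab h'.le
      rw [indicator_of_mem (s := K ∩ {x | a ≤ u x}) ⟨hx, h⟩, e]
      simp
    rw [indicator_of_mem (s := K ∩ {x | a ≤ u x}) ⟨hx, h⟩,
      indicator_of_mem (s := K ∩ {x | u x ≤ b}) ⟨hx, h'⟩,
      ← ENNReal.ofReal_add (abs_nonneg _) (abs_nonneg _)]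
    refine ENNReal.ofReal_le_ofReal ?_
    rw [show φ x * f n x + (1 - φ x) * g n x - F x =
      φ x * (f n x - F x) + (1 - φ x) * (g n x - F x) by ring]
    refine (abs_add_le _ _).trans ?_
    rw [abs_mul, abs_mul, abs_of_nonneg c0, abs_of_nonneg (sub_nonneg.2 c1)]
    gcongr
    · exact mul_le_of_le_one_left (abs_nonneg _) c1
    · exact mul_le_of_le_one_left (abs_nonneg _) (by linarith)
  have herr : Tendsto (fun n => ∫⁻ x in T, ENNReal.ofReal (1 / (b - a) * |f n x - g n x|) ∂m)
      atTop (𝓝 0) := by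
    have hlim := ENNReal.Tendsto.const_mul (a := ENNReal.ofReal (1 / (b - a)))
      ((f2 _ hT1 hT).add (g2 _ hT2 hT)) (Or.inr ENNReal.ofReal_ne_top)
    rw [add_zero, mul_zero] at hlim
    refine tendsto_of_tendsto_of_tendsto_of_le_of_le tendsto_const_nhds hlim
      (fun n => zero_le) fun n => ?_
    simp only
    rw [← lintegral_add_left' (aemeasurable_ofReal_abs_sub (f1 n) hF hT1 hT.measurableSet),
      ← lintegral_const_mul' _ _ ENNReal.ofReal_ne_top]
    refine lintegral_mono fun x => ?_
    have hba : 0 ≤ 1 / (b - a) := by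
      have : 0 < b - a := by linarith
      positivity
    rw [← ENNReal.ofReal_add (abs_nonneg _) (abs_nonneg _), ← ENNReal.ofReal_mul hba]
    refine ENNReal.ofReal_le_ofReal ?_
    gcongr
    rw [abs_sub_comm (g n x)]
    exact abs_sub_le _ _ _
  refine (totVar_le_of_seq hV subset_rfl hlip hconv hV.measurableSet).trans ?_
  have hev : ∀ᶠ n in atTop,
      ∫⁻ x in T, ENNReal.ofReal (1 / (b - a) * |f n x - g n x|) ∂m ≤ (ε : ℝ≥0∞) / 3 :=
    (herr.eventually (gt_mem_nhds (pos_iff_ne_zero.2 hε'))).mono fun n hn => hn.le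
  refine liminf_le_of_frequently_le (hev.mono fun n hn => ?_).frequently
  calc ∫⁻ x in V, mSlope (fun y => φ y * f n y + (1 - φ y) * g n y) x ∂m
      ≤ ∫⁻ x in V, (A₁.indicator (mSlope (f n)) x + A₂.indicator (mSlope (g n)) x +
        T.indicator (fun y => ENNReal.ofReal (1 / (b - a) * |f n y - g n y|)) x) ∂m :=
        setLIntegral_mono' hV.measurableSet fun x hx => (key n x hx).2
    _ ≤ ∫⁻ x, (A₁.indicator (mSlope (f n)) x + A₂.indicator (mSlope (g n)) x +
        T.indicator (fun y => ENNReal.ofReal (1 / (b - a) * |f n y - g n y|)) x) ∂m :=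
        setLIntegral_le_lintegral _ _
    _ = (∫⁻ x in A₁, mSlope (f n) x ∂m) + (∫⁻ x in A₂, mSlope (g n) x ∂m) +
        ∫⁻ x in T, ENNReal.ofReal (1 / (b - a) * |f n x - g n x|) ∂m := by
        have m1 := measurable_indicator_mSlope hA₁
          (fun x hx => (f1 n x hx).continuousAt.continuousWithinAt)
        have m2 := measurable_indicator_mSlope hA₂
          (fun x hx => (g1 n x hx).continuousAt.continuousWithinAt)
        have m3 : Measurable fun x =>
            A₁.indicator (mSlope (f n)) x + A₂.indicator (mSlope (g n)) x := m1.add m2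
        rw [lintegral_add_left m3, lintegral_add_left m1,
          lintegral_indicator hA₁.measurableSet, lintegral_indicator hA₂.measurableSet,
          lintegral_indicator hT.measurableSet]
    _ ≤ (totVar m F A₁ + ε / 3) + (totVar m F A₂ + ε / 3) + ε / 3 := by
        gcongr
        · exact (f3 n).le
        · exact (g3 n).le
    _ = totVar m F A₁ + totVar m F A₂ + ε := by
        conv_rhs => rw [← hε3]
        ring

end Glue

lemma measurable_indicator_one [MeasurableSpace X] {E : Set X} (hE : MeasurableSet E) :
    Measurable (E.indicator fun _ => (1 : ℝ)) := measurable_const.indicator hE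

section Localize

variable [MetricSpace X] [ProperSpace X] [MeasurableSpace X] [BorelSpace X] {m : Measure X}

lemma totVar_glue_ball {F : X → ℝ} (hF : Measurable F) {U : Set X} (hU : IsOpen U) {p : X}
    {a b : ℝ} (hab : a < b) (hb : ball p b ⊆ U) :
    totVar m F U ≤ totVar m F (ball p b) + totVar m F (U \ closedBall p a) := by
  have hc : IsCompact {x | a + (b - a) / 3 ≤ dist x p ∧ dist x p ≤ a + 2 * (b - a) / 3} := by
    refine (isCompact_closedBall p (a + 2 * (b - a) / 3)).of_isClosed_subset ?_ fun x hx => hx.2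
    exact (isClosed_le continuous_const (continuous_id.dist continuous_const)).inter
      (isClosed_le (continuous_id.dist continuous_const) continuous_const)
  refine totVar_glue hF (u := fun x => dist x p) (a := a + (b - a) / 3)
    (b := a + 2 * (b - a) / 3) (lipschitzWith_one_dist p) (by linarith) hU isOpen_ball
    (hU.sdiff isClosed_closedBall) hc ?_ ?_ ?_ ?_ ?_
  · intro x _ h
    rw [mem_ball]
    linarith
  · intro x hx h
    refine ⟨hx, fun h' => ?_⟩
    rw [mem_closedBall] at h'
    linarith
  · intro x _ h h'
    exact ⟨h, h'⟩
  · intro x hx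
    rw [mem_ball]
    linarith [hx.2]
  · intro x hx
    refine ⟨hb ?_, fun h' => ?_⟩
    · rw [mem_ball]
      linarith [hx.2]
    · rw [mem_closedBall] at h'
      linarith [hx.1]

lemma exists_open_totVar_lt_top_of_subset_iUnion {F : X → ℝ} (hF : Measurable F) {r : X → ℝ}
    (hr : ∀ x, totVar m F (ball x (r x)) < ∞) (t : Finset X) :
    ∀ K : Set X, IsCompact K → K ⊆ ⋃ x ∈ t, ball x (r x) →
      ∃ V, IsOpen V ∧ K ⊆ V ∧ totVar m F V < ∞ := by
  classical
  induction t using Finset.induction_on with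
  | empty =>
    intro K _ h
    refine ⟨∅, isOpen_empty, by simpa using h, ?_⟩
    refine (totVar_le_of_seq (fn := fun _ _ => 0) isOpen_empty subset_rfl
      (fun _ x hx => absurd hx (notMem_empty x)) ?_ MeasurableSet.empty).trans_lt ?_
    · intro K hK _
      simp [subset_empty_iff.1 hK]
    · simp
  | insert p t _ ih =>
    intro K hK hKt
    rw [Finset.set_biUnion_insert] at hKt
    set U := ⋃ x ∈ t, ball x (r x) with hU
    have hUo : IsOpen U := isOpen_biUnion fun x _ => isOpen_ball
    obtain ⟨a, ha, hKa⟩ : ∃ a < r p, K \ U ⊆ ball p a := by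
      refine exists_lt_subset_ball (hK.isClosed.sdiff hUo) fun x hx => ?_
      exact (hKt hx.1).resolve_right hx.2
    obtain ⟨C, hC, hKC, hCU⟩ := exists_compact_between (hK.diff (isOpen_ball (x := p) (ε := a)))
      hUo (fun x hx => by
        by_contra h
        exact hx.2 (hKa ⟨hx.1, h⟩))
    obtain ⟨A, hA, hCA, hAfin⟩ := ih C hC hCU
    refine ⟨interior C ∪ ball p a, isOpen_interior.union isOpen_ball, fun x hx => ?_, ?_⟩
    · by_cases h : x ∈ ball p a
      · exact Or.inr h
      · exact Or.inl (hKC ⟨hx, h⟩)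
    have hT : IsCompact (C ∩ {x | a + (r p - a) / 3 ≤ dist x p ∧
        dist x p ≤ a + 2 * (r p - a) / 3}) := by
      refine hC.inter_right ?_
      exact (isClosed_le continuous_const (continuous_id.dist continuous_const)).inter
        (isClosed_le (continuous_id.dist continuous_const) continuous_const)
    refine (totVar_glue hF (u := fun x => dist x p) (a := a + (r p - a) / 3)
      (b := a + 2 * (r p - a) / 3) (lipschitzWith_one_dist p) (by linarith)
      (isOpen_interior.union isOpen_ball) (isOpen_ball (x := p) (ε := r p))
      hA hT ?_ ?_ ?_ ?_ ?_).trans_lt (ENNReal.add_lt_top.2 ⟨hr p, hAfin⟩)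
    · intro x _ h
      rw [mem_ball]
      linarith
    · rintro x (hx | hx) h
      · exact hCA (interior_subset hx)
      · rw [mem_ball] at hx
        linarith
    · rintro x (hx | hx) h h'
      · exact ⟨interior_subset hx, h, h'⟩
      · rw [mem_ball] at hx
        linarith
    · intro x hx
      rw [mem_ball]
      linarith [hx.2.2]
    · exact fun x hx => hCA hx.1

lemma HasLocFinPer.exists_open {E : Set X} (hE : MeasurableSet E) (h : HasLocFinPer m E)
    {K : Set X} (hK : IsCompact K) : ∃ V, IsOpen V ∧ K ⊆ V ∧ Per m E V < ∞ := by
  choose r hr hr' using h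
  obtain ⟨t, -, ht⟩ := hK.elim_nhds_subcover (fun x => ball x (r x))
    fun x _ => ball_mem_nhds x (hr x)
  exact exists_open_totVar_lt_top_of_subset_iUnion (measurable_indicator_one hE) hr' t K hK ht

/-- A deformation inequality in a ball propagates to any larger open set. -/
lemma Per_union_ball_le {E : Set X} (hE : MeasurableSet E) {z y : X} {R r : ℝ}
    (hy : dist y z < R) (hrR : r < R) {Ω : Set X} (hΩ : IsOpen Ω)
    (hU : ball z (2 * R) ⊆ Ω) (hfin : Per m E (ball z (2 * R)) < ∞) {c : ℝ≥0∞}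
    (h : Per m (E ∪ ball y r) (ball z (2 * R)) ≤ c + Per m E (ball z (2 * R))) :
    Per m (E ∪ ball y r) Ω ≤ c + Per m E Ω := by
  set U := ball z (2 * R) with hUdef
  set E₁ := E ∪ ball y r with hE₁def
  have hE₁ : MeasurableSet E₁ := hE.union measurableSet_ball
  set T₀ := dist y z + r with hT₀
  have hT₀R : T₀ < 2 * R := by linarith
  have hsub : ∀ t, T₀ ≤ t → ball y r ⊆ closedBall z t := fun t ht x hx => by
    rw [mem_ball] at hx
    rw [mem_closedBall]
    linarith [dist_triangle x y z]
  have hcongr : ∀ t, T₀ ≤ t → ∀ W : Set X, IsOpen W →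
      Per m E₁ (W \ closedBall z t) = Per m E (W \ closedBall z t) := by
    intro t ht W hW
    refine Per_congr_open (hW.sdiff isClosed_closedBall) fun x hx => ?_
    refine ⟨fun hx' => hx'.resolve_right fun hx'' => hx.2 (hsub t ht hx''), Or.inl⟩
  refine ENNReal.le_of_forall_pos_le_add fun ε hε hfin' => ?_
  have hle : (⨆ t : Ioo T₀ (2 * R), Per m E (ball z t)) ≤ Per m E U :=
    iSup_le fun t => totVar_mono (ball_subset_ball t.2.2.le)
  have hε0 : (ε : ℝ≥0∞) ≠ 0 := by simpa using hε.ne'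
  obtain ⟨t, ht, htε⟩ : ∃ t ∈ Ioo T₀ (2 * R), ∀ t' ∈ Ioo T₀ (2 * R),
      Per m E (ball z t') ≤ Per m E (ball z t) + ε := by
    by_contra! hcon
    set s := ⨆ t : Ioo T₀ (2 * R), Per m E (ball z t) with hs
    have hs' : s + ε ≤ s := by
      have : Nonempty (Ioo T₀ (2 * R)) := (nonempty_Ioo_subtype hT₀R)
      rw [hs, ENNReal.iSup_add]
      refine iSup_le fun t => ?_
      obtain ⟨t', ht', h'⟩ := hcon t t.2
      exact h'.le.trans (le_iSup (fun t : Ioo T₀ (2 * R) => Per m E (ball z t)) ⟨t', ht'⟩)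
    exact absurd hs' (not_le.2 (ENNReal.lt_add_right (hle.trans_lt hfin).ne hε0))
  have ht1 := ht.1
  have ht2 := ht.2
  obtain ⟨t'', h1, h2⟩ := exists_between ht.2
  obtain ⟨t', h3, h4⟩ := exists_between h1
  have e1 : Per m E₁ Ω ≤ Per m E₁ (ball z t') + Per m E (Ω \ closedBall z t) := by
    rw [← hcongr t ht1.le Ω hΩ]
    exact totVar_glue_ball (measurable_indicator_one hE₁) hΩ h3
      ((ball_subset_ball (by linarith)).trans hU)
  have e2 : Per m E₁ (ball z t') ≤ c + Per m E (ball z t'') := by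
    have hle' : Per m E (U \ closedBall z t') < ∞ := (totVar_mono sdiff_subset).trans_lt hfin
    refine (ENNReal.add_le_add_iff_right hle'.ne).1 ?_
    calc Per m E₁ (ball z t') + Per m E (U \ closedBall z t')
        = Per m E₁ (ball z t') + Per m E₁ (U \ closedBall z t') := by
          rw [hcongr t' (by linarith) U isOpen_ball]
      _ ≤ Per m E₁ U := by
          refine totVar_add_le_of_disjoint isOpen_ball (isOpen_ball.sdiff isClosed_closedBall)
            ?_ (ball_subset_ball (by linarith)) sdiff_subset
          exact disjoint_left.2 fun x hx hx' => hx'.2 (ball_subset_closedBall hx)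
      _ ≤ c + Per m E U := h
      _ ≤ c + (Per m E (ball z t'') + Per m E (U \ closedBall z t')) := by
          gcongr
          exact totVar_glue_ball (measurable_indicator_one hE) isOpen_ball h4
            (ball_subset_ball h2.le)
      _ = _ := by ring
  have e3 : Per m E (ball z t) + Per m E (Ω \ closedBall z t) ≤ Per m E Ω := by
    refine totVar_add_le_of_disjoint isOpen_ball (hΩ.sdiff isClosed_closedBall)
      ?_ ((ball_subset_ball ht2.le).trans hU) sdiff_subset
    exact disjoint_left.2 fun x hx hx' => hx'.2 (ball_subset_closedBall hx)
  calc Per m E₁ Ω ≤ (c + (Per m E (ball z t) + ε)) + Per m E (Ω \ closedBall z t) := by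
        refine e1.trans ?_
        gcongr
        refine e2.trans ?_
        gcongr
        exact htε t'' ⟨by linarith, h2⟩
    _ = c + (Per m E (ball z t) + Per m E (Ω \ closedBall z t)) + ε := by ring
    _ ≤ c + Per m E Ω + ε := by gcongr

end Localize

section Cut

variable [MetricSpace X]

lemma cutoff_split {f u : X → ℝ} {a b : ℝ} (hu : LipschitzWith 1 u) (hab : a < b) {x : X}
    (hf : LipAt f x) :
    LipAt (fun y => cutoff u a b y * f y) x ∧ LipAt (fun y => (1 - cutoff u a b y) * f y) x ∧
    mSlope (fun y => cutoff u a b y * f y) x + mSlope (fun y => (1 - cutoff u a b y) * f y) x ≤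
      mSlope f x +
        {x | a ≤ u x ∧ u x ≤ b}.indicator
          (fun y => 2 * ENNReal.ofReal (1 / (b - a) * |f y|)) x := by
  have hba : 0 ≤ 1 / (b - a) := by
    have : 0 < b - a := by linarith
    positivity
  have e1 : (fun y => cutoff u a b y * f y) =
      fun y => cutoff u a b y * f y + (1 - cutoff u a b y) * (fun _ : X => (0 : ℝ)) y := by
    ext y
    ring
  have e2 : (fun y => (1 - cutoff u a b y) * f y) =
      fun y => cutoff u a b y * (fun _ : X => (0 : ℝ)) y + (1 - cutoff u a b y) * f y := by
    ext y
    ring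
  refine ⟨?_, ?_, ?_⟩
  · rw [e1]
    exact hf.interp (lipAt_const 0 x) (cutoff_nonneg _ _ _) (cutoff_le_one _ _ _)
      (cutoff_lipschitz hu hab)
  · rw [e2]
    exact (lipAt_const 0 x).interp hf (cutoff_nonneg _ _ _) (cutoff_le_one _ _ _)
      (cutoff_lipschitz hu hab)
  rcases lt_or_ge (u x) a with h | h
  · have h' := hu.continuous.continuousAt.eventually (gt_mem_nhds h)
    have e3 : (fun y => cutoff u a b y * f y) =ᶠ[𝓝 x] f := by
      filter_upwards [h'] with y hy
      rw [cutoff_eq_one hab hy.le, one_mul]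
    have e4 : (fun y => (1 - cutoff u a b y) * f y) =ᶠ[𝓝 x] fun _ => 0 := by
      filter_upwards [h'] with y hy
      rw [cutoff_eq_one hab hy.le, sub_self, zero_mul]
    rw [mSlope_congr e3, mSlope_congr e4, mSlope_const, add_zero]
    exact le_self_add
  rcases lt_or_ge b (u x) with h' | h'
  · have h' := hu.continuous.continuousAt.eventually (lt_mem_nhds h')
    have e3 : (fun y => cutoff u a b y * f y) =ᶠ[𝓝 x] fun _ => 0 := by
      filter_upwards [h'] with y hy
      rw [cutoff_eq_zero hab hy.le, zero_mul]
    have e4 : (fun y => (1 - cutoff u a b y) * f y) =ᶠ[𝓝 x] f := by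
      filter_upwards [h'] with y hy
      rw [cutoff_eq_zero hab hy.le, sub_zero, one_mul]
    rw [mSlope_congr e3, mSlope_congr e4, mSlope_const, zero_add]
    exact le_self_add
  have hlip : ∀ᶠ y in 𝓝 x, |cutoff u a b x - cutoff u a b y| ≤ 1 / (b - a) * dist x y := by
    refine Eventually.of_forall fun y => ?_
    have := (cutoff_lipschitz hu hab).dist_le_mul x y
    rwa [Real.dist_eq, Real.coe_toNNReal _ hba] at this
  have k1 := mSlope_interp hba hf.continuousAt (lipAt_const 0 x).continuousAt
    (cutoff_nonneg u a b x) (cutoff_le_one _ _ _ _) hlip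
  have k2 := mSlope_interp hba (lipAt_const 0 x).continuousAt hf.continuousAt
    (cutoff_nonneg u a b x) (cutoff_le_one _ _ _ _) hlip
  rw [← e1, mSlope_const, mul_zero, add_zero, sub_zero] at k1
  rw [← e2, mSlope_const, mul_zero, zero_add, zero_sub, abs_neg] at k2
  rw [indicator_of_mem (show x ∈ {x | a ≤ u x ∧ u x ≤ b} from ⟨h, h'⟩)]
  refine (add_le_add k1 k2).trans (le_of_eq ?_)
  have hsum : ENNReal.ofReal (cutoff u a b x) + ENNReal.ofReal (1 - cutoff u a b x) = 1 := by
    rw [← ENNReal.ofReal_add (cutoff_nonneg _ _ _ _)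
      (by linarith [cutoff_le_one u a b x])]
    simp
  calc _ = (ENNReal.ofReal (cutoff u a b x) + ENNReal.ofReal (1 - cutoff u a b x)) * mSlope f x
        + 2 * ENNReal.ofReal (1 / (b - a) * |f x|) := by ring
    _ = _ := by rw [hsum, one_mul]

lemma abs_cutoff_mul_sub_indicator_le {E : Set X} {f : X → ℝ} {p : X} {a b : ℝ} (hab : a < b)
    (x : X) :
    ENNReal.ofReal |cutoff (fun x => dist x p) a b x * f x -
        (E ∩ ball p a).indicator (fun _ => (1 : ℝ)) x| ≤
      ENNReal.ofReal |f x - E.indicator (fun _ => (1 : ℝ)) x| +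
        (E ∩ (closedBall p b \ ball p a)).indicator (fun _ => 1) x ∧
    ENNReal.ofReal |(1 - cutoff (fun x => dist x p) a b x) * f x -
        (E \ ball p a).indicator (fun _ => (1 : ℝ)) x| ≤
      ENNReal.ofReal |f x - E.indicator (fun _ => (1 : ℝ)) x| +
        (E ∩ (closedBall p b \ ball p a)).indicator (fun _ => 1) x := by
  set φ := cutoff (fun x => dist x p) a b with hφ
  have c0 : 0 ≤ φ x := cutoff_nonneg _ _ _ _
  have c1 : φ x ≤ 1 := cutoff_le_one _ _ _ _
  by_cases hE : x ∈ E
  swap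
  · rw [indicator_of_notMem (s := E ∩ ball p a) (fun h => hE h.1),
      indicator_of_notMem (s := E) hE,
      indicator_of_notMem (s := E \ ball p a) (fun h => hE h.1),
      indicator_of_notMem (s := E ∩ _) (fun h => hE h.1), add_zero, sub_zero, sub_zero, sub_zero,
      abs_mul, abs_mul, abs_of_nonneg c0, abs_of_nonneg (sub_nonneg.2 c1)]
    constructor
    · exact ENNReal.ofReal_le_ofReal (mul_le_of_le_one_left (abs_nonneg _) c1)
    · exact ENNReal.ofReal_le_ofReal (mul_le_of_le_one_left (abs_nonneg _) (by linarith))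
  rw [indicator_of_mem hE]
  by_cases h1 : x ∈ ball p a
  · have e : φ x = 1 := cutoff_eq_one hab (le_of_lt (mem_ball.1 h1))
    rw [indicator_of_mem (s := E ∩ ball p a) ⟨hE, h1⟩,
      indicator_of_notMem (s := E \ ball p a) (fun h => h.2 h1), e]
    constructor
    · rw [one_mul]
      exact le_self_add
    · simp
  rw [indicator_of_notMem (s := E ∩ ball p a) (fun h => h1 h.2),
      indicator_of_mem (s := E \ ball p a) ⟨hE, h1⟩]
  by_cases h2 : x ∈ closedBall p b
  · rw [indicator_of_mem (s := E ∩ (closedBall p b \ ball p a)) ⟨hE, h2, h1⟩, ← ENNReal.ofReal_one,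
      ← ENNReal.ofReal_add (abs_nonneg _) zero_le_one]
    constructor
    · refine ENNReal.ofReal_le_ofReal ?_
      rw [show φ x * f x - 0 = φ x * (f x - 1) + φ x by ring]
      refine (abs_add_le _ _).trans ?_
      rw [abs_mul, abs_of_nonneg c0]
      exact add_le_add (mul_le_of_le_one_left (abs_nonneg _) c1) c1
    · refine ENNReal.ofReal_le_ofReal ?_
      rw [show (1 - φ x) * f x - 1 = (1 - φ x) * (f x - 1) - φ x by ring]
      refine (abs_sub _ _).trans ?_
      rw [abs_mul, abs_of_nonneg c0, abs_of_nonneg (sub_nonneg.2 c1)]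
      exact add_le_add (mul_le_of_le_one_left (abs_nonneg _) (by linarith)) c1
  · have e : φ x = 0 := cutoff_eq_zero hab (by rw [mem_closedBall, not_le] at h2; exact h2.le)
    rw [e]
    constructor
    · simp
    · rw [sub_zero, one_mul]
      exact le_self_add

variable [ProperSpace X] [MeasurableSpace X] [BorelSpace X] {m : Measure X}

/-- Cutting a set along a ball at a radius at which the volume grows at most linearly. -/
lemma Per_cut_le {E : Set X} (hE : MeasurableSet E) {Ω : Set X} (hΩ : IsOpen Ω) {p : X}
    {S t₀ η L : ℝ} (hS : closedBall p S ⊆ Ω) (ht₀ : t₀ < S) (hη : 0 < η) (hL : 0 ≤ L)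
    (h : ∀ t ∈ Ioo t₀ (t₀ + η),
      m (E ∩ (closedBall p t \ ball p t₀)) ≤ ENNReal.ofReal (L * (t - t₀))) :
    Per m (E \ ball p t₀) Ω + Per m (E ∩ ball p t₀) Ω ≤ Per m E Ω + 2 * ENNReal.ofReal L := by
  have hEm := measurable_indicator_one hE
  refine le_of_forall_gt fun c hc => ?_
  obtain ⟨c', hc', hc''⟩ : ∃ c' > Per m E Ω, c' + 2 * ENNReal.ofReal L < c := by
    rcases eq_or_ne c ⊤ with rfl | hct
    · obtain ⟨c', h1, h2⟩ := exists_between ((le_self_add.trans_lt hc : Per m E Ω < ⊤))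
      exact ⟨c', h1, ENNReal.add_lt_top.2
        ⟨h2, ENNReal.mul_lt_top (by simp) ENNReal.ofReal_lt_top⟩⟩
    · obtain ⟨d, hd, hd'⟩ := ENNReal.lt_iff_exists_add_pos_lt.1 hc
      refine ⟨Per m E Ω + d, ENNReal.lt_add_right
        (ne_top_of_le_ne_top hct (le_self_add.trans hc.le)) (by simpa using hd.ne'), ?_⟩
      rwa [add_right_comm]
  obtain ⟨f, f1, f2, f3⟩ := exists_seq_of_totVar_open_lt (m := m) hc'
  set η' := min η (S - t₀) with hη'
  have hη'0 : 0 < η' := lt_min hη (by linarith)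
  set δ : ℕ → ℝ := fun k => η' / ((k : ℝ) + 2) with hδ
  have hδ0 : ∀ k, 0 < δ k := fun k => by positivity
  have hδ1 : ∀ k, δ k < η' := fun k => by
    rw [hδ]
    simp only
    rw [div_lt_iff₀ (by positivity)]
    nlinarith [(Nat.cast_nonneg k : (0 : ℝ) ≤ k)]
  have hδlim : Tendsto δ atTop (𝓝 0) :=
    tendsto_const_nhds.div_atTop (tendsto_atTop_add_const_right _ _ tendsto_natCast_atTop_atTop)
  have hn : ∀ k : ℕ, ∃ n ≥ k, ∫⁻ x in closedBall p S,
      ENNReal.ofReal |f n x - E.indicator (fun _ => (1 : ℝ)) x| ∂m ≤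
        ENNReal.ofReal (δ k / ((k : ℝ) + 1)) := fun k => by
    have h0 : (0 : ℝ≥0∞) < ENNReal.ofReal (δ k / ((k : ℝ) + 1)) :=
      ENNReal.ofReal_pos.2 (div_pos (hδ0 k) (by positivity))
    obtain ⟨n, hn, hn'⟩ := (((f2 _ hS (isCompact_closedBall p S)).eventually
      (gt_mem_nhds h0)).and (eventually_ge_atTop k)).exists
    exact ⟨n, hn', hn.le⟩
  choose N hN hN' using hn
  set F : ℕ → X → ℝ := fun k => f (N k) with hF
  have hFlim : TendstoL1loc m Ω F (E.indicator fun _ => (1 : ℝ)) :=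
    f2.comp (tendsto_atTop_mono hN tendsto_id)
  set φ : ℕ → X → ℝ := fun k => cutoff (fun x => dist x p) t₀ (t₀ + δ k) with hφ
  have hab : ∀ k, t₀ < t₀ + δ k := fun k => by linarith [hδ0 k]
  have hmE : ∀ k, m (E ∩ (closedBall p (t₀ + δ k) \ ball p t₀)) ≤ ENNReal.ofReal (L * δ k) :=
    fun k => by
      have := h (t₀ + δ k) ⟨hab k, by linarith [hδ1 k, min_le_left η (S - t₀)]⟩
      rwa [add_sub_cancel_left] at this
  have hsplit := fun k x (hx : x ∈ Ω) =>
    cutoff_split (lipschitzWith_one_dist p) (hab k) (f1 (N k) x hx)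
  have hmlim : Tendsto (fun k => m (E ∩ (closedBall p (t₀ + δ k) \ ball p t₀))) atTop (𝓝 0) := by
    have : Tendsto (fun k => ENNReal.ofReal (L * δ k)) atTop (𝓝 0) := by
      have := (ENNReal.continuous_ofReal.tendsto _).comp (hδlim.const_mul L)
      simpa [Function.comp_def] using this
    exact tendsto_of_tendsto_of_tendsto_of_le_of_le tendsto_const_nhds this
      (fun _ => zero_le) hmE
  have hms : ∀ k, MeasurableSet (E ∩ (closedBall p (t₀ + δ k) \ ball p t₀)) := fun k =>
    hE.inter (measurableSet_closedBall.diff measurableSet_ball)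
  have hconv : ∀ (G : Set X) (g : ℕ → X → ℝ), (∀ k x,
      ENNReal.ofReal |g k x - G.indicator (fun _ => (1 : ℝ)) x| ≤
      ENNReal.ofReal |F k x - E.indicator (fun _ => (1 : ℝ)) x| +
        (E ∩ (closedBall p (t₀ + δ k) \ ball p t₀)).indicator (fun _ => 1) x) →
      TendstoL1loc m Ω g (G.indicator fun _ => (1 : ℝ)) := by
    intro G g hg K hKΩ hK
    have hlim := (hFlim K hKΩ hK).add hmlim
    rw [add_zero] at hlim
    refine tendsto_of_tendsto_of_tendsto_of_le_of_le tendsto_const_nhds hlim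
      (fun n => zero_le) fun k => (lintegral_mono (hg k)).trans ?_
    rw [lintegral_add_right _ (measurable_const.indicator (hms k)),
      lintegral_indicator (hms k)]
    gcongr
    rw [setLIntegral_one]
    exact Measure.restrict_le_self _
  have hP := totVar_le_of_seq (m := m) hΩ subset_rfl (fun k x hx => (hsplit k x hx).1)
    (hconv (E ∩ ball p t₀) _ fun k x => (abs_cutoff_mul_sub_indicator_le (hab k) x).1)
    hΩ.measurableSet
  have hQ := totVar_le_of_seq (m := m) hΩ subset_rfl (fun k x hx => (hsplit k x hx).2.1)
    (hconv (E \ ball p t₀) _ fun k x => (abs_cutoff_mul_sub_indicator_le (hab k) x).2)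
    hΩ.measurableSet
  have hT : ∀ k, IsCompact {x | t₀ ≤ dist x p ∧ dist x p ≤ t₀ + δ k} := fun k => by
    refine (isCompact_closedBall p (t₀ + δ k)).of_isClosed_subset ?_ fun x hx => hx.2
    exact (isClosed_le continuous_const (continuous_id.dist continuous_const)).inter
      (isClosed_le (continuous_id.dist continuous_const) continuous_const)
  have hTS : ∀ k, {x | t₀ ≤ dist x p ∧ dist x p ≤ t₀ + δ k} ⊆ closedBall p S := fun k x hx => by
    rw [mem_closedBall]
    linarith [hx.2, hδ1 k, min_le_right η (S - t₀)]
  have herr : ∀ k, ∫⁻ x in {x | t₀ ≤ dist x p ∧ dist x p ≤ t₀ + δ k},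
      ENNReal.ofReal (1 / δ k * |F k x|) ∂m ≤ ENNReal.ofReal (1 / ((k : ℝ) + 1) + L) := fun k => by
    have hd := hδ0 k
    calc ∫⁻ x in {x | t₀ ≤ dist x p ∧ dist x p ≤ t₀ + δ k}, ENNReal.ofReal (1 / δ k * |F k x|) ∂m
        ≤ ∫⁻ x in {x | t₀ ≤ dist x p ∧ dist x p ≤ t₀ + δ k}, ENNReal.ofReal (1 / δ k) *
          (ENNReal.ofReal |F k x - E.indicator (fun _ => (1 : ℝ)) x| +
            E.indicator (fun _ => 1) x) ∂m := by
          refine lintegral_mono fun x => ?_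
          rw [ENNReal.ofReal_mul (by positivity)]
          gcongr
          have : E.indicator (fun _ => (1 : ℝ≥0∞)) x =
              ENNReal.ofReal |E.indicator (fun _ => (1 : ℝ)) x| := by
            by_cases hx : x ∈ E <;> simp [hx]
          rw [this, ← ENNReal.ofReal_add (abs_nonneg _) (abs_nonneg _)]
          refine ENNReal.ofReal_le_ofReal ?_
          have := abs_add_le (F k x - E.indicator (fun _ => (1 : ℝ)) x)
            (E.indicator (fun _ => (1 : ℝ)) x)
          rwa [sub_add_cancel] at this
      _ = ENNReal.ofReal (1 / δ k) * ((∫⁻ x in {x | t₀ ≤ dist x p ∧ dist x p ≤ t₀ + δ k},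
            ENNReal.ofReal |F k x - E.indicator (fun _ => (1 : ℝ)) x| ∂m) +
            m (E ∩ {x | t₀ ≤ dist x p ∧ dist x p ≤ t₀ + δ k})) := by
          rw [lintegral_const_mul' _ _ ENNReal.ofReal_ne_top,
            lintegral_add_right _ (measurable_const.indicator hE), lintegral_indicator hE]
          simp [Measure.restrict_apply hE]
      _ ≤ ENNReal.ofReal (1 / δ k) * (ENNReal.ofReal (δ k / ((k : ℝ) + 1)) +
            ENNReal.ofReal (L * δ k)) := by
          gcongr
          · exact (lintegral_mono_set (hTS k)).trans (hN' k)
          · refine (measure_mono fun x hx => ?_).trans (hmE k)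
            refine ⟨hx.1, hx.2.2, fun h' => ?_⟩
            rw [mem_ball] at h'
            linarith [hx.2.1]
      _ = _ := by
          rw [← ENNReal.ofReal_add (by positivity) (by positivity),
            ← ENNReal.ofReal_mul (by positivity)]
          congr 1
          field_simp
  rw [add_comm]
  refine (add_le_add hP hQ).trans_lt ((liminf_add_le_of_ennreal _ _ _).trans_lt ?_)
  have hlim : Tendsto (fun k : ℕ => c' + 2 * ENNReal.ofReal (1 / ((k : ℝ) + 1) + L)) atTop
      (𝓝 (c' + 2 * ENNReal.ofReal L)) := by
    refine tendsto_const_nhds.add (ENNReal.Tendsto.const_mul ?_ (Or.inr (by simp)))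
    refine (ENNReal.continuous_ofReal.tendsto _).comp ?_
    simpa using (tendsto_one_div_add_atTop_nhds_zero_nat (𝕜 := ℝ)).add_const L
  refine (liminf_le_liminf (Eventually.of_forall fun k => ?_)).trans_lt
    (hlim.liminf_eq.trans_lt hc'')
  refine (le_lintegral_add _ _).trans ?_
  refine (setLIntegral_mono' hΩ.measurableSet fun x hx => (hsplit k x hx).2.2).trans ?_
  rw [lintegral_add_right' , lintegral_indicator (hT k).measurableSet]
  · refine add_le_add (f3 _).le ?_
    rw [lintegral_const_mul' _ _ (by simp)]
    gcongr
    refine le_trans ?_ (herr k)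
    rw [add_sub_cancel_left]
    exact lintegral_mono' (Measure.restrict_mono subset_rfl Measure.restrict_le_self) le_rfl
  · refine (aemeasurable_indicator_iff (hT k).measurableSet).2 ?_
    have hcont : ContinuousOn (f (N k)) {x | t₀ ≤ dist x p ∧ dist x p ≤ t₀ + δ k} :=
      fun x hx => (f1 (N k) x (hS (hTS k hx))).continuousAt.continuousWithinAt
    have hae : AEMeasurable (f (N k))
        ((m.restrict Ω).restrict {x | t₀ ≤ dist x p ∧ dist x p ≤ t₀ + δ k}) :=
      hcont.aemeasurable (hT k).measurableSet
    exact ((continuous_abs.measurable.comp_aemeasurable hae).const_mul _).ennreal_ofReal.const_mul _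

end Cut

lemma exists_lt_two_pow_mul {r : ℝ} (hr : 0 < r) (s : ℝ) :
    ∃ N : ℕ, s < 2 ^ N * r ∧ 2 ^ N * r ≤ max r (2 * s) := by
  have hex : ∃ N : ℕ, s < 2 ^ N * r := by
    obtain ⟨N, hN⟩ := pow_unbounded_of_one_lt (s / r) (one_lt_two : (1 : ℝ) < 2)
    exact ⟨N, by rwa [← div_lt_iff₀ hr]⟩
  classical
  refine ⟨Nat.find hex, Nat.find_spec hex, ?_⟩
  rcases hn : Nat.find hex with _ | n
  · simp
  · have := Nat.find_min hex (m := n) (by omega)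
    rw [not_lt] at this
    refine le_max_of_le_right ?_
    rw [pow_succ]
    linarith

section Doubling

variable [MetricSpace X] [MeasurableSpace X]

/-- A locally doubling measure that is finite on bounded sets and charges all balls. -/
structure LocDoubling (m : Measure X) : Prop where
  pos : ∀ x r, 0 < r → 0 < m (ball x r)
  fin : ∀ B : Set X, IsBounded B → m B < ∞
  dbl : ∀ R > 0, ∃ D : ℝ, 1 ≤ D ∧ ∀ x r, 0 < r → r < R →
    m.real (ball x (2 * r)) ≤ D * m.real (ball x r)

variable {m : Measure X}

lemma LocDoubling.of_ne_zero (hbf : BoundedlyFinite m) {C_D : ℝ → ℝ}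
    (hD : UnifLocDoublingWith C_D m) (hm : m ≠ 0) : LocDoubling m where
  pos x r hr := by
    by_contra h
    have h0 : m (ball x r) = 0 := by simpa using h
    have hn : ∀ n : ℕ, m (ball x (2 ^ n * r)) = 0 := fun n => by
      induction n with
      | zero => simpa using h0
      | succ n ih =>
        have := hD (2 ^ n * r + 1) (by positivity) x (2 ^ n * r) (by positivity) (by linarith)
        rw [ih, mul_zero] at this
        rw [pow_succ', mul_assoc]
        exact le_antisymm this zero_le
    refine hm (Measure.measure_univ_eq_zero.1 ?_)
    have : (univ : Set X) = ⋃ n : ℕ, ball x (2 ^ n * r) := by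
      refine (eq_univ_of_forall fun y => mem_iUnion.2 ?_).symm
      obtain ⟨n, hn⟩ := pow_unbounded_of_one_lt (dist y x / r) (one_lt_two : (1 : ℝ) < 2)
      exact ⟨n, by rwa [mem_ball, ← div_lt_iff₀ hr]⟩
    rw [this]
    exact measure_iUnion_null hn
  fin := hbf
  dbl R hR := by
    refine ⟨max 1 (C_D R), le_max_left _ _, fun x r hr hrR => ?_⟩
    have h := ENNReal.toReal_mono (ENNReal.mul_ne_top ENNReal.ofReal_ne_top
      (hbf _ isBounded_ball).ne) (hD R hR x r hr hrR)
    rw [ENNReal.toReal_mul, ENNReal.toReal_ofReal'] at h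
    refine h.trans (mul_le_mul_of_nonneg_right ?_ measureReal_nonneg)
    rw [max_comm]
    exact max_le_max_right _ zero_le_one

lemma LocDoubling.ball_ne_top (h : LocDoubling m) (x : X) (r : ℝ) : m (ball x r) ≠ ∞ :=
  (h.fin _ isBounded_ball).ne

lemma LocDoubling.real_pos (h : LocDoubling m) (x : X) {r : ℝ} (hr : 0 < r) :
    0 < m.real (ball x r) :=
  ENNReal.toReal_pos (h.pos x r hr).ne' (h.ball_ne_top x r)

lemma LocDoubling.real_mono (h : LocDoubling m) {A B : Set X} (hAB : A ⊆ B)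
    (hB : IsBounded B) : m.real A ≤ m.real B :=
  measureReal_mono hAB (h.fin B hB).ne

lemma doubling_pow {D R : ℝ} (hD1 : 1 ≤ D) (hD : ∀ x r, 0 < r → r < R →
    m.real (ball x (2 * r)) ≤ D * m.real (ball x r)) (N : ℕ) (x : X) {r : ℝ} (hr : 0 < r)
    (hR : 2 ^ N * r < 2 * R) : m.real (ball x (2 ^ N * r)) ≤ D ^ N * m.real (ball x r) := by
  induction N with
  | zero => simp
  | succ N ih =>
    have hp : (0 : ℝ) < 2 ^ N * r := by positivity
    rw [pow_succ', mul_assoc] at hR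
    have h1 := ih (by linarith)
    have h2 := hD x (2 ^ N * r) hp (by linarith)
    calc m.real (ball x (2 ^ (N + 1) * r)) = m.real (ball x (2 * (2 ^ N * r))) := by ring_nf
      _ ≤ D * m.real (ball x (2 ^ N * r)) := h2
      _ ≤ D * (D ^ N * m.real (ball x r)) := by gcongr
      _ = D ^ (N + 1) * m.real (ball x r) := by ring

lemma LocDoubling.isUnifLocDoublingMeasure (h : LocDoubling m) : IsUnifLocDoublingMeasure m := by
  obtain ⟨D, hD1, hD⟩ := h.dbl 1 one_pos
  refine ⟨Real.toNNReal (D ^ 2), ?_⟩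
  filter_upwards [Ioo_mem_nhdsGT (show (0 : ℝ) < 1 / 2 by norm_num)] with r hr x
  have h1 := doubling_pow hD1 hD 2 x hr.1 (by linarith [hr.2])
  have h2 : m.real (closedBall x (2 * r)) ≤ D ^ 2 * m.real (closedBall x r) := by
    calc m.real (closedBall x (2 * r)) ≤ m.real (ball x (2 ^ 2 * r)) :=
          h.real_mono (closedBall_subset_ball (by linarith [hr.1])) isBounded_ball
      _ ≤ D ^ 2 * m.real (ball x r) := h1
      _ ≤ D ^ 2 * m.real (closedBall x r) := by
          gcongr
          · exact (h.fin _ isBounded_closedBall).ne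
          · exact ball_subset_closedBall
  rw [← ENNReal.ofReal_toReal (h.fin _ (isBounded_closedBall (x := x) (r := 2 * r))).ne,
    ← ENNReal.ofReal_toReal (h.fin _ (isBounded_closedBall (x := x) (r := r))).ne,
    ENNReal.ofNNReal_toNNReal, ← ENNReal.ofReal_mul (by positivity)]
  exact ENNReal.ofReal_le_ofReal h2

lemma LocDoubling.isLocallyFiniteMeasure (h : LocDoubling m) : IsLocallyFiniteMeasure m :=
  ⟨fun x => ⟨ball x 1, ball_mem_nhds x one_pos, h.fin _ isBounded_ball⟩⟩

lemma LocDoubling.properSpace [CompleteSpace X] [BorelSpace X] (h : LocDoubling m) :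
    ProperSpace X := by
  refine ⟨fun p S => ?_⟩
  refine TotallyBounded.isCompact_of_isClosed ?_ isClosed_closedBall
  rcases lt_or_ge S 0 with hS | hS
  · rw [closedBall_eq_empty.2 hS]
    exact totallyBounded_empty
  refine totallyBounded_iff.2 fun ε hε => ?_
  obtain ⟨u, huS, hdisj, hcov⟩ := Vitali.exists_disjoint_subfamily_covering_enlargement_closedBall
    (closedBall p S) (fun x => x) (fun _ => ε / 8) (ε / 8) (fun _ _ => le_rfl) 4 (by norm_num)
  obtain ⟨D, hD1, hD⟩ := h.dbl (2 * S + ε + 1) (by positivity)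
  obtain ⟨N, hN1, hN2⟩ := exists_lt_two_pow_mul (show 0 < ε / 8 by positivity) (S + ε)
  have hN3 : 2 ^ N * (ε / 8) < 2 * (2 * S + ε + 1) :=
    hN2.trans_lt (max_lt (by linarith) (by linarith))
  have hfin : u.Finite := by
    have hlow : ∀ x ∈ u, ENNReal.ofReal (m.real (ball p (ε / 8)) / D ^ N) ≤
        m (closedBall x (ε / 8)) := fun x hx => by
      have hxS : dist x p ≤ S := huS hx
      have h1 := doubling_pow hD1 hD N x (show 0 < ε / 8 by positivity) hN3
      refine ENNReal.ofReal_le_of_le_toReal ?_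
      rw [div_le_iff₀ (by positivity)]
      calc m.real (ball p (ε / 8)) ≤ m.real (ball x (2 ^ N * (ε / 8))) := by
            refine h.real_mono (ball_subset_ball' ?_) isBounded_ball
            rw [dist_comm]
            linarith
        _ ≤ D ^ N * m.real (ball x (ε / 8)) := h1
        _ ≤ D ^ N * m.real (closedBall x (ε / 8)) := by
            gcongr
            · exact (h.fin _ isBounded_closedBall).ne
            · exact ball_subset_closedBall
        _ = _ := mul_comm _ _
    have hc : 0 < ENNReal.ofReal (m.real (ball p (ε / 8)) / D ^ N) :=
      ENNReal.ofReal_pos.2 (div_pos (h.real_pos p (by positivity)) (by positivity))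
    have := Measure.finite_const_le_meas_of_disjoint_iUnion m hc
      (As := fun x : u => closedBall (x : X) (ε / 8)) (fun _ => measurableSet_closedBall)
      (fun a b hab => hdisj a.2 b.2 fun h => hab (Subtype.ext h)) ?_
    · have huniv : {i : u | ENNReal.ofReal (m.real (ball p (ε / 8)) / D ^ N) ≤
          m (closedBall (i : X) (ε / 8))} = univ := eq_univ_of_forall fun i => hlow i i.2
      rw [huniv] at this
      exact (finite_univ_iff.1 this)
    · refine (h.fin _ ((isBounded_closedBall (x := p) (r := S + ε / 8)).subset ?_)).ne
      refine iUnion_subset fun x => closedBall_subset_closedBall' ?_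
      linarith [show dist (x : X) p ≤ S from huS x.2]
  refine ⟨u, hfin, fun x hx => ?_⟩
  obtain ⟨b, hb, hxb⟩ := hcov x hx
  refine mem_biUnion hb ?_
  have := hxb (mem_closedBall_self (by positivity))
  rw [mem_closedBall] at this
  rw [mem_ball]
  linarith

end Doubling

section Density

variable [MetricSpace X] [MeasurableSpace X] {m : Measure X}

lemma LocDoubling.mem_essExt_iff (h : LocDoubling m) {A : Set X} {x : X} :
    x ∈ essExt m A ↔ ∀ ε > 0, ∃ ρ > 0, ∀ r ∈ Ioo 0 ρ,
      m.real (A ∩ ball x r) ≤ ε * m.real (ball x r) := by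
  have key : ∀ ε > 0, ∀ r > 0, (m.real (A ∩ ball x r) ≤ ε * m.real (ball x r) ↔
      m (A ∩ ball x r) / m (ball x r) ≤ ENNReal.ofReal ε) := by
    intro ε hε r hr
    have h1 : m (A ∩ ball x r) ≠ ∞ := (h.fin _ (isBounded_ball.subset inter_subset_right)).ne
    rw [ENNReal.div_le_iff (h.pos x r hr).ne' (h.ball_ne_top x r),
      ← ENNReal.ofReal_toReal (h.ball_ne_top x r), ← ENNReal.ofReal_mul hε.le,
      ENNReal.le_ofReal_iff_toReal_le h1 (by positivity)]
    rfl
  rw [essExt, mem_ofPred_eq, ENNReal.tendsto_nhds_zero]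
  constructor
  · intro H ε hε
    obtain ⟨ρ, hρ, hρ'⟩ := mem_nhdsGT_iff_exists_Ioo_subset.1
      (H (ENNReal.ofReal ε) (ENNReal.ofReal_pos.2 hε))
    exact ⟨ρ, hρ, fun r hr => (key ε hε r hr.1).2 (hρ' hr)⟩
  · intro H ε hε
    rcases eq_or_ne ε ∞ with rfl | hε'
    · exact Eventually.of_forall fun _ => le_top
    have hε0 := ENNReal.toReal_pos hε.ne' hε'
    obtain ⟨ρ, hρ, hρ'⟩ := H ε.toReal hε0
    filter_upwards [Ioo_mem_nhdsGT hρ] with r hr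
    have := (key _ hε0 r hr.1).1 (hρ' r hr)
    rwa [ENNReal.ofReal_toReal hε'] at this

lemma LocDoubling.mem_essInt_iff (h : LocDoubling m) {A : Set X} (hA : MeasurableSet A) {x : X} :
    x ∈ essInt m A ↔ x ∈ essExt m Aᶜ := by
  have key : ∀ B : Set X, MeasurableSet B → ∀ r > 0,
      m (Bᶜ ∩ ball x r) / m (ball x r) = 1 - m (B ∩ ball x r) / m (ball x r) := by
    intro B hB r hr
    have e : m (B ∩ ball x r) + m (Bᶜ ∩ ball x r) = m (ball x r) := by
      rw [inter_comm, inter_comm Bᶜ, ← Set.sdiff_eq]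
      exact measure_inter_add_sdiff _ hB
    have hne : m (B ∩ ball x r) / m (ball x r) ≠ ∞ := by
      refine ENNReal.div_ne_top (h.fin _ (isBounded_ball.subset inter_subset_right)).ne ?_
      exact (h.pos x r hr).ne'
    refine ENNReal.eq_sub_of_add_eq hne ?_
    rw [← ENNReal.add_div, add_comm, e]
    exact ENNReal.div_self (h.pos x r hr).ne' (h.ball_ne_top x r)
  constructor
  · intro H
    have := (ENNReal.Tendsto.sub (tendsto_const_nhds (x := (1 : ℝ≥0∞))) H (Or.inl (by simp)))
    rw [tsub_self] at this
    refine this.congr' ?_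
    filter_upwards [self_mem_nhdsWithin] with r hr
    exact (key A hA r hr).symm
  · intro H
    have := (ENNReal.Tendsto.sub (tendsto_const_nhds (x := (1 : ℝ≥0∞))) H (Or.inl (by simp)))
    rw [tsub_zero] at this
    refine this.congr' ?_
    filter_upwards [self_mem_nhdsWithin] with r hr
    have := key Aᶜ hA.compl r hr
    rw [compl_compl] at this
    exact this.symm

lemma essInt_inter_essExt (A : Set X) : essInt m A ∩ essExt m A = ∅ := by
  refine eq_empty_of_forall_notMem fun x hx => ?_
  exact one_ne_zero (tendsto_nhds_unique (show Tendsto _ _ _ from hx.1) hx.2)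

lemma LocDoubling.measure_diff_essInt [BorelSpace X] [TopologicalSpace.SeparableSpace X] (h : LocDoubling m)
    {A : Set X} (hA : MeasurableSet A) : m (A \ essInt m A) = 0 := by
  have := h.isUnifLocDoublingMeasure
  have := h.isLocallyFiniteMeasure
  have : SecondCountableTopology X := UniformSpace.secondCountable_of_separable X
  have hae := IsUnifLocDoublingMeasure.ae_tendsto_measure_inter_div m A 1
  rw [ae_restrict_iff' hA] at hae
  refine measure_mono_null (fun x hx => ?_) hae
  intro H
  refine hx.2 ((h.mem_essInt_iff hA).2 (h.mem_essExt_iff.2 fun ε hε => ?_))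
  have H1 := H hx.1 (l := 𝓝[>] (0 : ℝ)) (fun _ => x) (fun r => r) tendsto_id (by
    filter_upwards [self_mem_nhdsWithin] with r hr
    exact mem_closedBall_self (by rw [one_mul]; exact le_of_lt hr))
  have H2 := (ENNReal.tendsto_toReal one_ne_top).comp H1
  obtain ⟨D, hD1, hD⟩ := h.dbl 1 one_pos
  have hD0 : 0 < D := by linarith
  have H3 := H2.eventually (lt_mem_nhds (show 1 - ε / D < (1 : ℝ≥0∞).toReal by
    rw [ENNReal.toReal_one]
    linarith [div_pos hε hD0]))
  obtain ⟨ρ, hρ, hρ'⟩ := mem_nhdsGT_iff_exists_Ioo_subset.1 H3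
  refine ⟨min ρ 1, lt_min hρ one_pos, fun r hr => ?_⟩
  have hr1 : r < 1 := hr.2.trans_le (min_le_right _ _)
  have h1 : 1 - ε / D < m.real (A ∩ closedBall x r) / m.real (closedBall x r) := by
    have := hρ' ⟨hr.1, hr.2.trans_le (min_le_left _ _)⟩
    simpa [ENNReal.toReal_div, Measure.real] using this
  have hc : 0 < m.real (closedBall x r) :=
    (h.real_pos x hr.1).trans_le (h.real_mono ball_subset_closedBall isBounded_closedBall)
  rw [lt_div_iff₀ hc] at h1
  have h2 : m.real (Aᶜ ∩ closedBall x r) + m.real (A ∩ closedBall x r) =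
      m.real (closedBall x r) := by
    rw [inter_comm, inter_comm A, ← Set.sdiff_eq, add_comm]
    exact measureReal_inter_add_sdiff hA (h.fin _ isBounded_closedBall).ne
  have h3 : m.real (closedBall x r) ≤ D * m.real (ball x r) :=
    (h.real_mono (closedBall_subset_ball (by linarith [hr.1])) isBounded_ball).trans
      (hD x r hr.1 hr1)
  have h4 : m.real (Aᶜ ∩ ball x r) ≤ m.real (Aᶜ ∩ closedBall x r) :=
    h.real_mono (inter_subset_inter_right _ ball_subset_closedBall)
      (isBounded_closedBall.subset inter_subset_right)
  calc m.real (Aᶜ ∩ ball x r) ≤ ε / D * m.real (closedBall x r) := by linarith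
    _ ≤ ε / D * (D * m.real (ball x r)) := by gcongr
    _ = ε * m.real (ball x r) := by field_simp

end Density

section Length

variable [MetricSpace X]

lemma IsLengthSpace.exists_curve (hlen : IsLengthSpace X) (x y : X) {c : ℝ} (hc : dist x y < c) :
    ∃ γ : ℝ → X, ContinuousOn γ (Icc 0 1) ∧ γ 0 = x ∧ γ 1 = y ∧
      eVariationOn γ (Icc 0 1) < ENNReal.ofReal c := by
  have h := (hlen x y).symm.trans_lt
    ((ENNReal.ofReal_lt_ofReal_iff (dist_nonneg.trans_lt hc)).2 hc)
  simp only [iInf_lt_iff] at h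
  obtain ⟨γ, h1, h2, h3, h4⟩ := h
  exact ⟨γ, h1, h2, h3, h4⟩

lemma IsLengthSpace.preconnectedSpace (hlen : IsLengthSpace X) : PreconnectedSpace X := by
  refine ⟨isPreconnected_of_forall_pair fun x _ y _ => ?_⟩
  obtain ⟨γ, h1, h2, h3, -⟩ := hlen.exists_curve x y (lt_add_one _)
  exact ⟨γ '' Icc 0 1, subset_univ _, ⟨0, by simp, h2⟩, ⟨1, by simp, h3⟩,
    isPreconnected_Icc.image _ h1⟩

lemma IsLengthSpace.exists_dist_lt (hlen : IsLengthSpace X) {x y : X} {ρ : ℝ} (hρ : 0 < ρ)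
    (h : ρ < dist x y) : ∃ z, dist x z = ρ ∧ dist z y < dist x y - ρ / 2 := by
  obtain ⟨γ, h1, h2, h3, h4⟩ := hlen.exists_curve x y
    (show dist x y < dist x y + ρ / 2 by linarith)
  have hcont : ContinuousOn (fun t => dist x (γ t)) (Icc 0 1) :=
    fun t ht => tendsto_const_nhds.dist (h1 t ht)
  obtain ⟨τ, hτ, hτ'⟩ := intermediate_value_Icc zero_le_one hcont
    (show ρ ∈ Icc (dist x (γ 0)) (dist x (γ 1)) by
      rw [h2, h3, dist_self]
      exact ⟨hρ.le, h.le⟩)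
  refine ⟨γ τ, hτ', ?_⟩
  have e1 := eVariationOn.edist_le γ (s := Icc 0 τ) (left_mem_Icc.2 hτ.1) (right_mem_Icc.2 hτ.1)
  have e2 := eVariationOn.edist_le γ (s := Icc τ 1) (left_mem_Icc.2 hτ.2) (right_mem_Icc.2 hτ.2)
  have e3 := eVariationOn.Icc_add_Icc γ (s := univ) hτ.1 hτ.2 (mem_univ _)
  simp only [univ_inter] at e3
  have e4 : edist x (γ τ) + edist (γ τ) y < ENNReal.ofReal (dist x y + ρ / 2) := by
    rw [h2] at e1
    rw [h3] at e2
    exact (add_le_add e1 e2).trans_lt (e3.trans_lt h4)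
  rw [edist_dist, edist_dist, ← ENNReal.ofReal_add dist_nonneg dist_nonneg,
    ENNReal.ofReal_lt_ofReal_iff (by linarith)] at e4
  have : dist x (γ τ) = ρ := hτ'
  linarith

variable [MeasurableSpace X] {m : Measure X}

/-- A density point of `A` cannot lie on the closure of a ball that `A` does not charge. -/
lemma LocDoubling.lt_dist_of_null (h : LocDoubling m) (hlen : IsLengthSpace X) {A : Set X}
    {x y : X} {R₀ : ℝ} (hR₀ : 0 < R₀) (hA : m (A ∩ ball y R₀) = 0)
    (hx : x ∈ essExt m Aᶜ) : R₀ < dist x y := by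
  by_contra! hd
  obtain ⟨D, hD1, hD⟩ := h.dbl 4 (by norm_num)
  obtain ⟨ρ₀, hρ₀, hρ⟩ := h.mem_essExt_iff.1 hx (1 / (2 * D ^ 3)) (by positivity)
  have hz : ∃ ρ > 0, 2 * ρ < ρ₀ ∧ ρ < 1 ∧ ∃ z, dist x z ≤ ρ ∧ ball z (ρ / 2) ⊆ ball y R₀ := by
    rcases hd.lt_or_eq with hd | hd
    · set ρ := min (ρ₀ / 4) (min (1 / 2) (R₀ - dist x y)) with hρdef
      have h1 : ρ ≤ ρ₀ / 4 := min_le_left _ _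
      have h2 : ρ ≤ 1 / 2 := (min_le_right _ _).trans (min_le_left _ _)
      have h3 : ρ ≤ R₀ - dist x y := (min_le_right _ _).trans (min_le_right _ _)
      have h4 : 0 < ρ := lt_min (by linarith) (lt_min (by norm_num) (by linarith))
      exact ⟨ρ, h4, by linarith, by linarith, x, by simpa using h4.le,
        ball_subset_ball' (by linarith)⟩
    · set ρ := min (ρ₀ / 4) (min (1 / 2) (R₀ / 2)) with hρdef
      have h1 : ρ ≤ ρ₀ / 4 := min_le_left _ _
      have h2 : ρ ≤ 1 / 2 := (min_le_right _ _).trans (min_le_left _ _)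
      have h3 : ρ ≤ R₀ / 2 := (min_le_right _ _).trans (min_le_right _ _)
      have h4 : 0 < ρ := lt_min (by linarith) (lt_min (by norm_num) (by linarith))
      obtain ⟨z, hz1, hz2⟩ := hlen.exists_dist_lt (x := x) (y := y) h4 (by linarith)
      exact ⟨ρ, h4, by linarith, by linarith, z, hz1.le, ball_subset_ball' (by linarith)⟩
  obtain ⟨ρ, hρ0, hρ1, hρ2, z, hz1, hz2⟩ := hz
  have e1 := hρ (2 * ρ) ⟨by linarith, hρ1⟩
  have e2 := doubling_pow hD1 hD 3 z (show 0 < ρ / 2 by linarith) (by linarith)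
  have e3 : m.real (ball x (2 * ρ)) ≤ m.real (ball z (2 ^ 3 * (ρ / 2))) :=
    h.real_mono (ball_subset_ball' (by linarith)) isBounded_ball
  have e4 : m.real (ball z (ρ / 2)) ≤ m.real (Aᶜ ∩ ball x (2 * ρ)) := by
    refine ENNReal.toReal_mono
      (h.fin _ (isBounded_ball.subset inter_subset_right)).ne ?_
    calc m (ball z (ρ / 2)) ≤ m (A ∩ ball y R₀ ∪ Aᶜ ∩ ball x (2 * ρ)) := by
          refine measure_mono fun w hw => ?_
          by_cases hwA : w ∈ A
          · exact Or.inl ⟨hwA, hz2 hw⟩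
          · refine Or.inr ⟨hwA, ball_subset_ball' ?_ hw⟩
            rw [dist_comm]
            linarith
      _ ≤ m (A ∩ ball y R₀) + m (Aᶜ ∩ ball x (2 * ρ)) := measure_union_le _ _
      _ = _ := by rw [hA, zero_add]
  have hpos := h.real_pos z (show 0 < ρ / 2 by linarith)
  have : m.real (ball z (ρ / 2)) ≤ 1 / 2 * m.real (ball z (ρ / 2)) := by
    calc m.real (ball z (ρ / 2)) ≤ 1 / (2 * D ^ 3) * m.real (ball x (2 * ρ)) := e4.trans e1
      _ ≤ 1 / (2 * D ^ 3) * (D ^ 3 * m.real (ball z (ρ / 2))) := by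
          gcongr
          exact e3.trans e2
      _ = _ := by field_simp
  linarith

variable [BorelSpace X] [TopologicalSpace.SeparableSpace X]

lemma LocDoubling.sphere_null (h : LocDoubling m) (hlen : IsLengthSpace X) (y : X) {r : ℝ}
    (hr : 0 < r) : m (sphere y r) = 0 := by
  have hs : MeasurableSet (sphere y r) := isClosed_sphere.measurableSet
  refine measure_mono_null (fun x hx => ?_) (h.measure_diff_essInt hs)
  refine ⟨hx, fun hx' => ?_⟩
  have := h.lt_dist_of_null hlen (y := y) hr (by
    rw [show sphere y r ∩ ball y r = ∅ from eq_empty_of_forall_notMem fun z hz =>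
      (mem_ball.1 hz.2).ne (mem_sphere.1 hz.1), measure_empty]) ((h.mem_essInt_iff hs).1 hx')
  rw [mem_sphere.1 hx] at this
  exact lt_irrefl _ this

lemma LocDoubling.continuousOn_inter_ball (h : LocDoubling m) (hlen : IsLengthSpace X)
    {A : Set X} (hA : MeasurableSet A) (y : X) :
    ContinuousOn (fun r => m.real (A ∩ ball y r)) (Ioi 0) := by
  intro r hr
  refine ContinuousAt.continuousWithinAt ?_
  refine (ENNReal.tendsto_toReal (h.fin _ (isBounded_ball.subset inter_subset_right)).ne).comp ?_
  refine tendsto_measure_of_ae_tendsto_indicator (𝓝 r) (hA.inter measurableSet_ball)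
    (fun s => hA.inter measurableSet_ball) (measurableSet_ball (x := y) (ε := r + 1))
    (h.ball_ne_top _ _) ?_ ?_
  · filter_upwards [gt_mem_nhds (lt_add_one r)] with s hs
    exact inter_subset_right.trans (ball_subset_ball hs.le)
  · have hn : ∀ᵐ x ∂m, x ∉ sphere y r := measure_eq_zero_iff_ae_notMem.1 (h.sphere_null hlen y hr)
    filter_upwards [hn] with x hx
    rw [mem_sphere] at hx
    rcases lt_or_gt_of_ne hx with hx | hx
    · filter_upwards [lt_mem_nhds hx] with s hs
      simp [mem_ball, hx, hs]
    · filter_upwards [gt_mem_nhds hx] with s hs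
      simp [mem_ball, not_lt.2 hx.le, not_lt.2 hs.le]

end Length

section Isoperimetric

variable [MetricSpace X] [MeasurableSpace X] {m : Measure X}

/-- At a point of density one, some dyadic radius has comparable mass inside and outside. -/
lemma LocDoubling.exists_balanced_radius (h : LocDoubling m) {D R : ℝ} (hD1 : 1 ≤ D)
    (hD : ∀ x r, 0 < r → r < R → m.real (ball x (2 * r)) ≤ D * m.real (ball x r)) {G : Set X}
    (hG : MeasurableSet G) {x : X} (hx : x ∈ essInt m G) {ρ : ℝ} (hρ : 0 < ρ) (hρR : ρ < R)
    (hGρ : 2 * m.real (G ∩ ball x ρ) ≤ m.real (ball x ρ)) :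
    ∃ r, 0 < r ∧ r ≤ ρ ∧ m.real (ball x r) ≤ 2 * D * m.real (G ∩ ball x r) ∧
      m.real (ball x r) ≤ 2 * D * m.real (ball x r \ G) := by
  have hsplit : ∀ r, m.real (G ∩ ball x r) + m.real (ball x r \ G) = m.real (ball x r) := by
    intro r
    rw [inter_comm]
    exact measureReal_inter_add_sdiff hG (h.ball_ne_top x r)
  have hex : ∃ k : ℕ, m.real (ball x (ρ / 2 ^ k)) < 2 * m.real (G ∩ ball x (ρ / 2 ^ k)) := by
    obtain ⟨s, hs, hs'⟩ := h.mem_essExt_iff.1 ((h.mem_essInt_iff hG).1 hx) (1 / 4) (by norm_num)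
    obtain ⟨k, hk⟩ := pow_unbounded_of_one_lt (ρ / s) (one_lt_two : (1 : ℝ) < 2)
    refine ⟨k, ?_⟩
    have hk0 : 0 < ρ / 2 ^ k := by positivity
    have h1 := hs' (ρ / 2 ^ k) ⟨hk0, by
      rw [div_lt_iff₀ (by positivity)]
      rwa [div_lt_iff₀ hs, mul_comm] at hk⟩
    have h2 := hsplit (ρ / 2 ^ k)
    rw [inter_comm, ← Set.sdiff_eq] at h1
    have h3 := h.real_pos x hk0
    linarith
  classical
  have hspec := Nat.find_spec hex
  rcases hn : Nat.find hex with _ | n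
  · rw [hn] at hspec
    simp only [pow_zero, div_one] at hspec
    linarith
  · have hmin := Nat.find_min hex (m := n) (by omega)
    rw [hn] at hspec
    rw [not_lt] at hmin
    set r := ρ / 2 ^ n with hr
    have hr0 : 0 < r := by positivity
    have hrρ : r ≤ ρ := div_le_self hρ.le (one_le_pow₀ one_le_two)
    have hr2 : ρ / 2 ^ (n + 1) = r / 2 := by rw [hr, pow_succ, div_div]
    rw [hr2] at hspec
    have h1 := hD x (r / 2) (by positivity) (by linarith)
    rw [show 2 * (r / 2) = r by ring] at h1
    have h2 : m.real (G ∩ ball x (r / 2)) ≤ m.real (G ∩ ball x r) :=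
      h.real_mono (inter_subset_inter_right _ (ball_subset_ball (by linarith)))
        (isBounded_ball.subset inter_subset_right)
    have h3 := hsplit r
    have h4 : 0 ≤ m.real (ball x r \ G) := measureReal_nonneg
    refine ⟨r, hr0, hrρ, ?_, ?_⟩
    · calc m.real (ball x r) ≤ D * m.real (ball x (r / 2)) := h1
        _ ≤ D * (2 * m.real (G ∩ ball x r)) := by
          gcongr
          linarith
        _ = _ := by ring
    · nlinarith

variable [BorelSpace X]

/-- The Poincaré inequality for a locally Lipschitz function close to an indicator function. -/
lemma WeakPoincareWith.min_le {lam : ℝ} {C_P : ℝ → ℝ} (hP : WeakPoincareWith lam C_P m)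
    (h : LocDoubling m) (hlam : 1 ≤ lam) {R : ℝ} (hR : 0 < R) {f : X → ℝ}
    (hf : LocLipOn univ f) {G : Set X} (hG : MeasurableSet G) (x : X) {r : ℝ} (hr : 0 < r)
    (hrR : r < R) :
    min (m (G ∩ ball x r)) (m (ball x r \ G)) ≤
      2 * ∫⁻ y in ball x r, ENNReal.ofReal |f y - G.indicator (fun _ => (1 : ℝ)) y| ∂m +
      2 * (ENNReal.ofReal (C_P R * r) * ∫⁻ y in ball x (lam * r), mSlope f y ∂m) := by
  have hp := hP f hf R hR x r hr hrR
  set c := ⨍ z in ball x r, f z ∂m with hc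
  have hlr : 0 < lam * r := by positivity
  have hB0 := (h.pos x r hr).ne'
  have hBt := h.ball_ne_top x r
  have hp' : ∫⁻ y in ball x r, ENNReal.ofReal |f y - c| ∂m ≤
      ENNReal.ofReal (C_P R * r) * ∫⁻ y in ball x (lam * r), mSlope f y ∂m := by
    rw [ENNReal.div_le_iff hB0 hBt] at hp
    refine hp.trans ?_
    rw [mul_assoc]
    gcongr
    rw [div_eq_mul_inv, mul_assoc]
    refine mul_le_of_le_one_right zero_le ?_
    rw [mul_comm, ← div_eq_mul_inv]
    refine ENNReal.div_le_of_le_mul ?_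
    rw [one_mul]
    exact measure_mono (ball_subset_ball (by nlinarith))
  have hcont : Continuous f := continuousOn_univ.1 (hf.continuousOn isOpen_univ)
  have hmeas : Measurable fun y => ENNReal.ofReal |f y - c| :=
    (by fun_prop : Continuous fun y => |f y - c|).measurable.ennreal_ofReal
  have hI : ∫⁻ y in ball x r, ENNReal.ofReal |G.indicator (fun _ => (1 : ℝ)) y - c| ∂m ≤
      ∫⁻ y in ball x r, ENNReal.ofReal |f y - G.indicator (fun _ => (1 : ℝ)) y| ∂m +
      ∫⁻ y in ball x r, ENNReal.ofReal |f y - c| ∂m := by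
    rw [← lintegral_add_right _ hmeas]
    refine lintegral_mono fun y => ?_
    dsimp only
    rw [← ENNReal.ofReal_add (abs_nonneg _) (abs_nonneg _)]
    refine ENNReal.ofReal_le_ofReal ?_
    rw [abs_sub_comm (f y) (G.indicator _ y)]
    exact abs_sub_le _ _ _
  have hmin : min (m (G ∩ ball x r)) (m (ball x r \ G)) ≤
      2 * ∫⁻ y in ball x r, ENNReal.ofReal |G.indicator (fun _ => (1 : ℝ)) y - c| ∂m := by
    have key : ∀ A : Set X, MeasurableSet A → A ⊆ ball x r →
        (∀ y ∈ A, (1 / 2 : ℝ) ≤ |G.indicator (fun _ => (1 : ℝ)) y - c|) →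
        m A ≤ 2 * ∫⁻ y in ball x r, ENNReal.ofReal |G.indicator (fun _ => (1 : ℝ)) y - c| ∂m := by
      intro A hA hAB hle
      calc m A = 2 * ∫⁻ _ in A, ENNReal.ofReal (1 / 2) ∂m := by
            rw [setLIntegral_const, ← mul_assoc,
              show (2 : ℝ≥0∞) = ENNReal.ofReal 2 by simp, ← ENNReal.ofReal_mul (by norm_num)]
            norm_num
        _ ≤ 2 * ∫⁻ y in A, ENNReal.ofReal |G.indicator (fun _ => (1 : ℝ)) y - c| ∂m := by
            gcongr 2 * ?_
            exact setLIntegral_mono' hA fun y hy => ENNReal.ofReal_le_ofReal (hle y hy)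
        _ ≤ _ := by
            gcongr 2 * ?_
            exact lintegral_mono_set hAB
    rcases le_total c (1 / 2) with hc2 | hc2
    · refine (min_le_left _ _).trans (key _ (hG.inter measurableSet_ball) inter_subset_right ?_)
      intro y hy
      rw [indicator_of_mem hy.1]
      exact le_trans (by linarith) (le_abs_self _)
    · refine (min_le_right _ _).trans (key _ (measurableSet_ball.diff hG) sdiff_subset ?_)
      intro y hy
      rw [indicator_of_notMem hy.2]
      exact le_trans (by linarith) (neg_le_abs _)
  calc _ ≤ _ := hmin
    _ ≤ 2 * (_ + _) := by gcongr
    _ = _ := mul_add _ _ _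
    _ ≤ _ := by gcongr

/-- A local isoperimetric inequality for sets of small density. -/
lemma WeakPoincareWith.isoperimetric [ProperSpace X] {lam : ℝ} {C_P : ℝ → ℝ}
    (hP : WeakPoincareWith lam C_P m) (h : LocDoubling m) (hlam : 1 ≤ lam)
    (hC : ∀ R, 0 < R → 0 < C_P R) :
    ∃ c > 0, ∀ (p : X) (S ρ : ℝ) (G : Set X), MeasurableSet G → G ⊆ ball p S → 0 < ρ → ρ ≤ 1 →
      (∀ x ∈ ball p S, 2 * m.real G ≤ m.real (ball x ρ)) →
      ENNReal.ofReal (c * m.real G / ρ) ≤ Per m G univ := by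
  obtain ⟨N, hN⟩ := pow_unbounded_of_one_lt (4 * lam) (one_lt_two : (1 : ℝ) < 2)
  obtain ⟨D, hD1, hD⟩ := h.dbl (2 ^ N + 1) (by positivity)
  have hCP := hC 2 two_pos
  set K := D ^ (N + 1) * C_P 2 with hK
  have hK0 : 0 < K := by positivity
  refine ⟨1 / (8 * K), by positivity, fun p S ρ G hG hGS hρ hρ1 hdens => ?_⟩
  by_contra! hlt
  have hGb : IsBounded G := isBounded_ball.subset hGS
  have hGfin : m G ≠ ∞ := (h.fin _ hGb).ne
  obtain ⟨fn, hf1, hf2, hf3⟩ := exists_seq_of_totVar_open_lt hlt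
  have h2N : (1 : ℝ) ≤ 2 ^ N := one_le_pow₀ one_le_two
  have hrad : ∀ x ∈ G ∩ essInt m G, ∃ r, 0 < r ∧ r ≤ ρ ∧
      m.real (ball x r) ≤ 2 * D * m.real (G ∩ ball x r) ∧
      m.real (ball x r) ≤ 2 * D * m.real (ball x r \ G) := by
    intro x hx
    refine h.exists_balanced_radius hD1 hD hG hx.2 hρ (by linarith) ?_
    refine le_trans ?_ (hdens x (hGS hx.1))
    gcongr
    exact inter_subset_left
  choose! r hr0 hrρ hrG hrG' using hrad
  obtain ⟨u, hu, hdisj, hcov⟩ := Vitali.exists_disjoint_subfamily_covering_enlargement_closedBall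
    (G ∩ essInt m G) id (fun x => lam * r x) (lam * ρ)
    (fun x hx => by
      have := hrρ x hx
      gcongr) 4 (by norm_num)
  simp only [id] at hdisj hcov
  have hlr : ∀ x ∈ u, r x ≤ lam * r x := fun x hx => by nlinarith [hr0 x (hu hx)]
  have hcount : u.Countable := by
    refine hdisj.countable_of_nonempty_interior fun x hx => ⟨x, ?_⟩
    have := hr0 x (hu hx)
    exact ball_subset_interior_closedBall (mem_ball_self (by positivity))
  have : Countable u := hcount.to_subtype
  have hd1 : Pairwise (Function.onFun Disjoint fun x : u => ball (x : X) (lam * r x)) :=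
    fun a b hab => (hdisj a.2 b.2 fun e => hab (Subtype.ext e)).mono
      ball_subset_closedBall ball_subset_closedBall
  have hd2 : Pairwise (Function.onFun Disjoint fun x : u => ball (x : X) (r x)) :=
    fun a b hab => (hd1 hab).mono (ball_subset_ball (hlr a a.2)) (ball_subset_ball (hlr b b.2))
  have hball : ∀ x ∈ u, m (ball x (2 ^ N * r x)) ≤ ENNReal.ofReal (2 * D ^ (N + 1)) *
      min (m (G ∩ ball x (r x))) (m (ball x (r x) \ G)) := by
    intro x hx
    have hx0 := hr0 x (hu hx)
    have hxρ := hrρ x (hu hx)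
    have e1 := doubling_pow hD1 hD N x hx0 (by nlinarith)
    have e2 : m (ball x (2 ^ N * r x)) ≤ ENNReal.ofReal (D ^ N) * m (ball x (r x)) := by
      rw [← ENNReal.ofReal_toReal (h.ball_ne_top x (2 ^ N * r x)),
        ← ENNReal.ofReal_toReal (h.ball_ne_top x (r x)), ← ENNReal.ofReal_mul (by positivity)]
      exact ENNReal.ofReal_le_ofReal e1
    have e3 : m (ball x (r x)) ≤ ENNReal.ofReal (2 * D) *
        min (m (G ∩ ball x (r x))) (m (ball x (r x) \ G)) := by
      have f1 : m (G ∩ ball x (r x)) ≠ ∞ := (h.fin _ (isBounded_ball.subset inter_subset_right)).ne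
      have f2 : m (ball x (r x) \ G) ≠ ∞ := (h.fin _ (isBounded_ball.subset sdiff_subset)).ne
      rcases min_choice (m (G ∩ ball x (r x))) (m (ball x (r x) \ G)) with e | e <;> rw [e]
      · rw [← ENNReal.ofReal_toReal (h.ball_ne_top x (r x)), ← ENNReal.ofReal_toReal f1,
          ← ENNReal.ofReal_mul (by positivity)]
        exact ENNReal.ofReal_le_ofReal (hrG x (hu hx))
      · rw [← ENNReal.ofReal_toReal (h.ball_ne_top x (r x)), ← ENNReal.ofReal_toReal f2,
          ← ENNReal.ofReal_mul (by positivity)]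
        exact ENNReal.ofReal_le_ofReal (hrG' x (hu hx))
    calc _ ≤ _ := e2
      _ ≤ ENNReal.ofReal (D ^ N) * (ENNReal.ofReal (2 * D) *
        min (m (G ∩ ball x (r x))) (m (ball x (r x) \ G))) := by gcongr
      _ = _ := by
        rw [← mul_assoc, ← ENNReal.ofReal_mul (by positivity)]
        ring_nf
  have hGle : m G ≤ ∑' x : u, m (ball (x : X) (2 ^ N * r x)) := by
    refine le_trans ?_ (measure_iUnion_le _)
    calc m G ≤ m (G ∩ essInt m G ∪ G \ essInt m G) := measure_mono (inter_union_sdiff _ _).ge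
      _ ≤ m (G ∩ essInt m G) + m (G \ essInt m G) := measure_union_le _ _
      _ = m (G ∩ essInt m G) := by rw [h.measure_diff_essInt hG, add_zero]
      _ ≤ _ := by
        refine measure_mono fun x hx => ?_
        obtain ⟨b, hb, hxb⟩ := hcov x hx
        have hb0 := hr0 b (hu hb)
        have hx0 := hr0 x hx
        refine mem_iUnion.2 ⟨⟨b, hb⟩, closedBall_subset_ball ?_
          (hxb (mem_closedBall_self (by positivity)))⟩
        rw [← mul_assoc]
        exact mul_lt_mul_of_pos_right hN hb0
  set err : ℕ → ℝ≥0∞ := fun n => ∫⁻ y in closedBall p (S + 1),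
    ENNReal.ofReal |fn n y - G.indicator (fun _ => (1 : ℝ)) y| ∂m with herr
  have herr0 : Tendsto err atTop (𝓝 0) := hf2 _ (subset_univ _) (isCompact_closedBall _ _)
  have hbound : ∀ n, m G ≤ ENNReal.ofReal (2 * D ^ (N + 1)) * (2 * err n +
      2 * (ENNReal.ofReal (C_P 2 * ρ) * ENNReal.ofReal (1 / (8 * K) * m.real G / ρ))) := by
    intro n
    calc m G ≤ ∑' x : u, m (ball (x : X) (2 ^ N * r x)) := hGle
      _ ≤ ∑' x : u, ENNReal.ofReal (2 * D ^ (N + 1)) * (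
          2 * ∫⁻ y in ball (x : X) (r x),
            ENNReal.ofReal |fn n y - G.indicator (fun _ => (1 : ℝ)) y| ∂m +
          2 * (ENNReal.ofReal (C_P 2 * ρ) *
            ∫⁻ y in ball (x : X) (lam * r x), mSlope (fn n) y ∂m)) := by
        refine ENNReal.tsum_le_tsum fun x => (hball x x.2).trans ?_
        have hxρ := hrρ x (hu x.2)
        gcongr ENNReal.ofReal (2 * D ^ (N + 1)) * ?_
        refine (hP.min_le h hlam two_pos ((locLipOn_iff isOpen_univ).2 (hf1 n)) hG x
          (hr0 x (hu x.2)) (by linarith)).trans ?_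
        gcongr
      _ = ENNReal.ofReal (2 * D ^ (N + 1)) * (
          2 * ∫⁻ y in ⋃ x : u, ball (x : X) (r x),
            ENNReal.ofReal |fn n y - G.indicator (fun _ => (1 : ℝ)) y| ∂m +
          2 * (ENNReal.ofReal (C_P 2 * ρ) *
            ∫⁻ y in ⋃ x : u, ball (x : X) (lam * r x), mSlope (fn n) y ∂m)) := by
        rw [lintegral_iUnion (fun _ => measurableSet_ball) hd1,
          lintegral_iUnion (fun _ => measurableSet_ball) hd2, ENNReal.tsum_mul_left,
          ENNReal.tsum_add, ENNReal.tsum_mul_left, ENNReal.tsum_mul_left, ENNReal.tsum_mul_left]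
      _ ≤ _ := by
        gcongr
        · refine lintegral_mono_set (iUnion_subset fun x => ?_)
          have hxρ := hrρ x (hu x.2)
          have := mem_ball.1 (hGS (hu x.2).1)
          exact (ball_subset_ball' (by linarith)).trans ball_subset_closedBall
        · exact (lintegral_mono_set (subset_univ _)).trans (hf3 n).le
  have hlim := ge_of_tendsto' (ENNReal.Tendsto.const_mul
    ((ENNReal.Tendsto.const_mul (a := 2) herr0 (Or.inr (by simp))).add_const _)
    (Or.inr ENNReal.ofReal_ne_top)) hbound
  rw [mul_zero, zero_add, ← ENNReal.ofReal_mul (by positivity),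
    show (2 : ℝ≥0∞) = ENNReal.ofReal 2 by simp, ← ENNReal.ofReal_mul (by norm_num),
    ← ENNReal.ofReal_mul (by positivity)] at hlim
  have hlim' := ENNReal.toReal_mono ENNReal.ofReal_ne_top hlim
  have hG0 : 0 ≤ m.real G := measureReal_nonneg
  rw [ENNReal.toReal_ofReal (by positivity)] at hlim'
  have e : 2 * D ^ (N + 1) * (2 * (C_P 2 * ρ * (1 / (8 * K) * m.real G / ρ))) =
      m.real G / 2 := by
    rw [hK]
    field_simp
    norm_num
  rw [e] at hlim'
  have hz : m.real G = 0 := by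
    have : m.real G ≤ m.real G / 2 := hlim'
    linarith
  rw [hz] at hlt
  simp at hlt

end Isoperimetric

section SmallSets

variable [MetricSpace X] [MeasurableSpace X] {m : Measure X}

lemma exists_open_Per_lt {E B : Set X} {c : ℝ≥0∞} (h : Per m E B < c) :
    ∃ Ω, IsOpen Ω ∧ B ⊆ Ω ∧ Per m E Ω < c := by
  unfold Per totVar at h
  simp only [iInf_lt_iff] at h
  obtain ⟨Ω, hΩ, hB, fn, h1, h2, h3⟩ := h
  refine ⟨Ω, hΩ, hB, lt_of_le_of_lt ?_ h3⟩
  exact iInf₂_le_of_le Ω hΩ (iInf₂_le_of_le subset_rfl fn (iInf₂_le_of_le h1 h2 le_rfl))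

/-- A doubling measure has polynomial lower mass bounds at small scales. -/
lemma LocDoubling.exists_exponent (h : LocDoubling m) : ∃ Q : ℕ, 1 ≤ Q ∧
    ∀ (p x : X) (S ρ : ℝ), S ≤ 1 → x ∈ ball p S → 0 < ρ → ρ ≤ S →
      m.real (ball p S) ≤ (4 * S / ρ) ^ Q * m.real (ball x ρ) := by
  obtain ⟨D, hD1, hD⟩ := h.dbl 4 (by norm_num)
  obtain ⟨q, hq⟩ := pow_unbounded_of_one_lt D (one_lt_two : (1 : ℝ) < 2)
  refine ⟨q + 1, by omega, fun p x S ρ hS hx hρ hρS => ?_⟩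
  obtain ⟨N, hN, hN'⟩ := exists_lt_two_pow_mul hρ (2 * S)
  have hN4 : 2 ^ N * ρ ≤ 4 * S := hN'.trans (max_le (by linarith) (by linarith))
  have e1 := doubling_pow hD1 hD N x hρ (by linarith)
  have e2 : m.real (ball p S) ≤ m.real (ball x (2 ^ N * ρ)) :=
    h.real_mono (ball_subset_ball' (by
      rw [dist_comm]
      linarith [mem_ball.1 hx])) isBounded_ball
  refine (e2.trans e1).trans ?_
  gcongr
  calc D ^ N ≤ (2 ^ (q + 1)) ^ N := by
        gcongr
        exact hq.le.trans (pow_le_pow_right₀ one_le_two (by omega))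
    _ = (2 ^ N) ^ (q + 1) := by rw [← pow_mul, ← pow_mul, mul_comm]
    _ ≤ (4 * S / ρ) ^ (q + 1) := by
        gcongr
        rwa [le_div_iff₀ hρ]

/-- Isoperimetric inequality for sets of volume fraction at most `g ^ Q` in a small ball. -/
def SmallIso (m : Measure X) (c : ℝ) (Q : ℕ) : Prop :=
  ∀ (p : X) (S b g : ℝ) (G Ω : Set X), MeasurableSet G → G ⊆ ball p S → 0 < S → S ≤ 1 → 0 < g →
    g ≤ 1 / 16 → m.real G ≤ g ^ Q * m.real (ball p S) → S < b → ball p b ⊆ Ω →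
    ENNReal.ofReal (c * m.real G / (S * g)) ≤ Per m G Ω

variable [BorelSpace X]

lemma Per_eq_zero_of_disjoint {G Ω : Set X} (hΩ : IsOpen Ω) (h : Disjoint G Ω) :
    Per m G Ω = 0 := by
  rw [Per_congr_open (F := ∅) hΩ fun x hx =>
    iff_of_false (fun hG => disjoint_left.1 h hG hx) (notMem_empty x)]
  refine le_antisymm ?_ zero_le
  refine (totVar_le_of_seq (fn := fun _ _ => 0) hΩ subset_rfl (fun _ x _ => lipAt_const 0 x)
    (fun K _ _ => ?_) hΩ.measurableSet).trans ?_
  · simp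
  · simp [mSlope_const]

lemma Per_univ_le [ProperSpace X] {G Ω : Set X} (hG : MeasurableSet G) {p : X} {S b : ℝ}
    (hGS : G ⊆ ball p S) (hSb : S < b) (hb : ball p b ⊆ Ω) : Per m G univ ≤ Per m G Ω := by
  have h1 := totVar_glue_ball (m := m) (measurable_indicator_one hG) isOpen_univ hSb
    (subset_univ (ball p b))
  have h2 : Per m G (univ \ closedBall p S) = 0 :=
    Per_eq_zero_of_disjoint (isOpen_univ.sdiff isClosed_closedBall)
      (disjoint_left.2 fun x hx hx' => hx'.2 (ball_subset_closedBall (hGS hx)))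
  calc Per m G univ ≤ Per m G (ball p b) + Per m G (univ \ closedBall p S) := h1
    _ = Per m G (ball p b) := by rw [h2, add_zero]
    _ ≤ Per m G Ω := totVar_mono hb

lemma WeakPoincareWith.exists_smallIso [ProperSpace X] {lam : ℝ} {C_P : ℝ → ℝ}
    (hP : WeakPoincareWith lam C_P m) (h : LocDoubling m) (hlam : 1 ≤ lam)
    (hC : ∀ R, 0 < R → 0 < C_P R) : ∃ c > 0, ∃ Q : ℕ, 1 ≤ Q ∧ SmallIso m c Q := by
  obtain ⟨c, hc, hiso⟩ := hP.isoperimetric h hlam hC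
  obtain ⟨Q, hQ, hmass⟩ := h.exists_exponent
  refine ⟨c / 8, by positivity, Q, hQ, ?_⟩
  intro p S b g G Ω hG hGS hS hS1 hg hg1 hGm hSb hb
  have e := hiso p S (8 * S * g) G hG hGS (by positivity) (by nlinarith) fun x hx => by
    have e1 := hmass p x S (8 * S * g) hS1 hx (by positivity) (by nlinarith)
    have e2 : g ^ Q * (4 * S / (8 * S * g)) ^ Q = (1 / 2) ^ Q := by
      rw [← mul_pow]
      congr 1
      field_simp
      norm_num
    have e3 : ((1 : ℝ) / 2) ^ Q ≤ 1 / 2 := pow_le_of_le_one (by norm_num) (by norm_num) (by omega)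
    have e4 : 0 ≤ m.real (ball x (8 * S * g)) := measureReal_nonneg
    calc 2 * m.real G ≤ 2 * (g ^ Q * ((4 * S / (8 * S * g)) ^ Q * m.real (ball x (8 * S * g)))) := by
          gcongr
          exact hGm.trans (by gcongr)
      _ = 2 * ((1 / 2) ^ Q * m.real (ball x (8 * S * g))) := by rw [← mul_assoc (g ^ Q), e2]
      _ ≤ 2 * (1 / 2 * m.real (ball x (8 * S * g))) := by gcongr
      _ = _ := by ring
  refine (le_of_eq ?_).trans (e.trans (Per_univ_le hG hGS hSb hb))
  congr 1
  field_simp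

end SmallSets

/-- If a continuous function grows slowly on `[a, b]`, it does so up to `b` from some point on. -/
lemma exists_forall_growth_lt {g : ℝ → ℝ} {a b κ : ℝ} (hab : a < b)
    (hg : ContinuousOn g (Icc a b)) (h : g b - g a < κ * (b - a)) :
    ∃ s ∈ Ico a b, ∀ t ∈ Ioc s b, g t - g s < κ * (t - s) := by
  set φ : ℝ → ℝ := fun t => κ * t - g t with hφ
  have hφc : ContinuousOn φ (Icc a b) := (continuous_const.mul continuous_id).continuousOn.sub hg
  set T := {t | t ∈ Icc a b ∧ φ t ≤ φ a} with hT
  have hTc : IsClosed T := by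
    have := hφc.preimage_isClosed_of_isClosed isClosed_Icc (isClosed_Iic (a := φ a))
    exact this
  have haT : a ∈ T := ⟨left_mem_Icc.2 hab.le, le_rfl⟩
  have hbdd : BddAbove T := ⟨b, fun t ht => ht.1.2⟩
  have hs : sSup T ∈ T := hTc.csSup_mem ⟨a, haT⟩ hbdd
  have hsb : sSup T < b := by
    refine lt_of_le_of_ne hs.1.2 fun e => ?_
    have := hs.2
    rw [e] at this
    simp only [hφ] at this
    linarith
  refine ⟨sSup T, ⟨hs.1.1, hsb⟩, fun t ht => ?_⟩
  have hnt : t ∉ T := fun h' => (le_csSup hbdd h').not_gt ht.1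
  have h1 : φ a < φ t := by
    by_contra! h'
    exact hnt ⟨⟨hs.1.1.trans ht.1.le, ht.2⟩, h'⟩
  have h2 := hs.2
  simp only [hφ] at h1 h2
  linarith

section RootMass

variable [MetricSpace X] [MeasurableSpace X] {m : Measure X}

/-- The `Q`-th root of the mass of `A` in the ball of radius `t` at `p`. -/
def rootMass (m : Measure X) (Q : ℕ) (A : Set X) (p : X) (t : ℝ) : ℝ :=
  m.real (A ∩ ball p t) ^ ((Q : ℝ)⁻¹)

lemma rootMass_nonneg (Q : ℕ) (A : Set X) (p : X) (t : ℝ) : 0 ≤ rootMass m Q A p t :=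
  Real.rpow_nonneg measureReal_nonneg _

lemma rootMass_pow {Q : ℕ} (hQ : 1 ≤ Q) (A : Set X) (p : X) (t : ℝ) :
    rootMass m Q A p t ^ Q = m.real (A ∩ ball p t) :=
  Real.rpow_inv_natCast_pow measureReal_nonneg (by omega)

lemma LocDoubling.rootMass_mono (h : LocDoubling m) (Q : ℕ) {A B : Set X} (hAB : A ⊆ B) (p : X)
    {s t : ℝ} (hst : s ≤ t) : rootMass m Q A p s ≤ rootMass m Q B p t :=
  Real.rpow_le_rpow measureReal_nonneg (h.real_mono (inter_subset_inter hAB (ball_subset_ball hst))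
    (isBounded_ball.subset inter_subset_right)) (by positivity)

lemma LocDoubling.continuousOn_rootMass [BorelSpace X] [TopologicalSpace.SeparableSpace X]
    (h : LocDoubling m) (hlen : IsLengthSpace X) (Q : ℕ) {A : Set X} (hA : MeasurableSet A)
    (p : X) : ContinuousOn (rootMass m Q A p) (Ioi 0) :=
  (h.continuousOn_inter_ball hlen hA p).rpow_const fun _ _ => Or.inr (by positivity)

end RootMass

lemma pow_sub_pow_le_mul {x y : ℝ} (hy : 0 ≤ y) (hyx : y ≤ x) (n : ℕ) :
    x ^ (n + 1) - y ^ (n + 1) ≤ (n + 1) * x ^ n * (x - y) := by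
  have hx : 0 ≤ x := hy.trans hyx
  induction n with
  | zero => simp
  | succ n ih =>
    have h1 : y ^ (n + 1) ≤ x ^ (n + 1) := by gcongr
    have h2 := mul_le_mul_of_nonneg_left ih hx
    have h3 := mul_le_mul_of_nonneg_right h1 (sub_nonneg.2 hyx)
    push_cast
    calc x ^ (n + 1 + 1) - y ^ (n + 1 + 1)
        = x * (x ^ (n + 1) - y ^ (n + 1)) + y ^ (n + 1) * (x - y) := by ring
      _ ≤ x * ((n + 1) * x ^ n * (x - y)) + x ^ (n + 1) * (x - y) := add_le_add h2 h3
      _ = _ := by ring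

section Core

variable [MetricSpace X] [ProperSpace X] [MeasurableSpace X] [BorelSpace X] {m : Measure X}

/-- Slow growth of the `Q`-th root of the volume makes cutting cheap. -/
lemma LocDoubling.annulus_le (h : LocDoubling m) (hlen : IsLengthSpace X) {Q : ℕ} (hQ : 1 ≤ Q)
    {E : Set X} (hE : MeasurableSet E) {p : X} {t₀ t κ : ℝ} (ht₀ : 0 < t₀) (ht : t₀ < t)
    (hg : rootMass m Q E p t - rootMass m Q E p t₀ ≤ κ * (t - t₀))
    (hκ : κ * (t - t₀) ≤ rootMass m Q E p t₀) :
    m (E ∩ (closedBall p t \ ball p t₀)) ≤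
      ENNReal.ofReal (Q * (2 * rootMass m Q E p t₀) ^ (Q - 1) * κ * (t - t₀)) := by
  obtain ⟨n, rfl⟩ : ∃ n, Q = n + 1 := ⟨Q - 1, by omega⟩
  set u₀ := rootMass m (n + 1) E p t₀ with hu₀
  set u := rootMass m (n + 1) E p t with hu
  have hu₀0 : 0 ≤ u₀ := rootMass_nonneg _ _ _ _
  have huu : u₀ ≤ u := h.rootMass_mono _ subset_rfl p ht.le
  have hfin : m (E ∩ (ball p t \ ball p t₀)) ≠ ∞ :=
    (h.fin _ (isBounded_ball.subset (inter_subset_right.trans sdiff_subset))).ne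
  have e1 : m (E ∩ (closedBall p t \ ball p t₀)) ≤ m (E ∩ (ball p t \ ball p t₀)) := by
    calc _ ≤ m (E ∩ (ball p t \ ball p t₀) ∪ sphere p t) := by
          refine measure_mono fun x hx => ?_
          rcases (mem_closedBall.1 hx.2.1).lt_or_eq with h' | h'
          · exact Or.inl ⟨hx.1, h', hx.2.2⟩
          · exact Or.inr h'
      _ ≤ m (E ∩ (ball p t \ ball p t₀)) + m (sphere p t) := measure_union_le _ _
      _ = _ := by rw [h.sphere_null hlen p (ht₀.trans ht), add_zero]
  refine e1.trans ?_
  rw [← ENNReal.ofReal_toReal hfin]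
  refine ENNReal.ofReal_le_ofReal ?_
  have e2 : m.real (E ∩ (ball p t \ ball p t₀)) = u ^ (n + 1) - u₀ ^ (n + 1) := by
    rw [hu, hu₀, rootMass_pow hQ, rootMass_pow hQ, inter_sdiff_distrib_left]
    rw [measureReal_sdiff (inter_subset_inter_right _ (ball_subset_ball ht.le))
      (hE.inter measurableSet_ball) (h.fin _ (isBounded_ball.subset inter_subset_right)).ne]
  calc m.real (E ∩ (ball p t \ ball p t₀)) = _ := e2
    _ ≤ (n + 1) * u ^ n * (u - u₀) := pow_sub_pow_le_mul hu₀0 huu n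
    _ ≤ (n + 1) * (2 * u₀) ^ n * (κ * (t - t₀)) := by
        have : 0 ≤ u - u₀ := sub_nonneg.2 huu
        have : 0 ≤ u := hu₀0.trans huu
        gcongr
        linarith
    _ = _ := by
        push_cast [Nat.add_sub_cancel]
        ring

/-- Moving a small piece of a volume-constrained minimizer from the ball around `p` to a ball
around `y` is impossible when the volume around `p` grows slowly. -/
lemma VolConstMin.not_exchange {E : Set X} (hE : VolConstMin m E) (h : LocDoubling m)
    (hlen : IsLengthSpace X) {c : ℝ} (hc : 0 < c) {Q : ℕ} (hQ : 1 ≤ Q) (hiso : SmallIso m c Q)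
    {p y z : X} {R C r₁ : ℝ} (hC : 0 ≤ C) (hdef : DeformIneq m E z R C) (hy : y ∈ ball z R)
    (hr₁R : r₁ < R) (hr₁ : r₁ < dist p y) :
    ∃ ε > 0, ∀ S t₀ r, 0 < S → S < ε → S / 2 ≤ t₀ → t₀ < S → t₀ ≤ r → r ≤ r₁ →
      0 < rootMass m Q E p t₀ → rootMass m Q E p S ≤ ε * rootMass m Q univ p S →
      (∀ t ∈ Ioc t₀ S, rootMass m Q E p t - rootMass m Q E p t₀ ≤
        ε * rootMass m Q univ p S / S * (t - t₀)) →
      m.real (ball y r \ E) ≠ m.real (E ∩ ball p t₀) := by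
  obtain ⟨hEm, hEfin, hmin⟩ := hE
  set M := 2 * C + Q * 2 ^ Q with hM
  have hQ0 : (0 : ℝ) < Q := by exact_mod_cast hQ
  have hM0 : 0 < M := by positivity
  refine ⟨min (1 / 16) (min (dist p y - r₁) (c / (2 * M))),
    lt_min (by norm_num) (lt_min (by linarith) (by positivity)), ?_⟩
  set ε := min (1 / 16) (min (dist p y - r₁) (c / (2 * M))) with hε
  have hε1 : ε ≤ 1 / 16 := min_le_left _ _
  have hε2 : ε ≤ dist p y - r₁ := (min_le_right _ _).trans (min_le_left _ _)
  have hε3 : ε ≤ c / (2 * M) := (min_le_right _ _).trans (min_le_right _ _)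
  have hε0 : 0 < ε := lt_min (by norm_num) (lt_min (by linarith) (by positivity))
  intro S t₀ r hS hSε hSt₀ ht₀S ht₀r hrr₁ hu₀ hsmall hgrow hvol
  have ht₀ : 0 < t₀ := by linarith
  have hr0 : 0 < r := by linarith
  have hrR : r < R := by linarith
  set u₀ := rootMass m Q E p t₀ with hu₀def
  set N := rootMass m Q univ p S with hN
  have hu₀S : u₀ ≤ ε * N := (h.rootMass_mono Q subset_rfl p ht₀S.le).trans hsmall
  have hN0 : 0 < N := pos_of_mul_pos_right (hu₀.trans_le hu₀S) hε0.le
  set g := u₀ / N with hg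
  have hg0 : 0 < g := by positivity
  have hgε : g ≤ ε := by rwa [hg, div_le_iff₀ hN0]
  set w := m.real (E ∩ ball p t₀) with hw
  have hwu : u₀ ^ Q = w := rootMass_pow hQ E p t₀
  have hw0 : 0 < w := by
    rw [← hwu]
    positivity
  set κ := ε * N / S with hκ
  have hκ0 : 0 < κ := by positivity
  set L := Q * (2 * u₀) ^ (Q - 1) * κ with hL
  have hL0 : 0 ≤ L := by positivity
  set W := w / (S * g) with hW
  have hW0 : 0 < W := by positivity
  have hLW : 2 * L = Q * 2 ^ Q * ε * W := by
    obtain ⟨n, rfl⟩ : ∃ n, Q = n + 1 := ⟨Q - 1, by omega⟩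
    rw [hL, hW, ← hwu, hκ, hg, Nat.add_sub_cancel]
    field_simp
    ring
  have hCW : C * w / r ≤ 2 * C * ε * W := by
    have e1 : C * w / r ≤ C * w / (S / 2) := by
      gcongr
      linarith
    have e2 : C * w / (S / 2) = 2 * C * g * W := by
      rw [hW]
      field_simp
    rw [e2] at e1
    exact e1.trans (by gcongr)
  have hAB : C * w / r + 2 * L < c * W := by
    have e1 : M * ε ≤ c / 2 := by
      rw [le_div_iff₀ (by positivity)] at hε3
      linarith
    calc C * w / r + 2 * L ≤ 2 * C * ε * W + Q * 2 ^ Q * ε * W := by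
          rw [hLW]
          gcongr
      _ = M * ε * W := by
          rw [hM]
          ring
      _ ≤ c / 2 * W := by gcongr
      _ < c * W := by
          gcongr
          linarith
  set G := E ∩ ball p t₀ with hG
  set E₁ := E ∪ ball y r with hE₁
  set E' := E₁ \ ball p t₀ with hE'
  have hE₁m : MeasurableSet E₁ := hEm.union measurableSet_ball
  have hE'm : MeasurableSet E' := hE₁m.diff measurableSet_ball
  have hGm : MeasurableSet G := hEm.inter measurableSet_ball
  have hfar : ∀ x, x ∈ ball y r → x ∉ closedBall p S := by
    intro x hx hx'
    rw [mem_ball] at hx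
    rw [mem_closedBall, dist_comm] at hx'
    linarith [dist_triangle p x y]
  have hfar' : ∀ x, x ∈ ball y r → x ∉ ball p t₀ := fun x hx hx' =>
    hfar x hx (closedBall_subset_closedBall ht₀S.le (ball_subset_closedBall hx'))
  have hE₁G : E₁ ∩ ball p t₀ = G := by
    ext x
    constructor
    · rintro ⟨hx | hx, hx'⟩
      · exact ⟨hx, hx'⟩
      · exact absurd hx' (hfar' x hx)
    · exact fun hx => ⟨Or.inl hx.1, hx.2⟩
  have hR0 : 0 < R := by linarith
  set T := S + 1 + dist p z + 2 * R + dist p y + r with hT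
  have hpz : 0 ≤ dist p z := dist_nonneg
  have hpy : 0 ≤ dist p y := dist_nonneg
  set K := closedBall p T with hK
  have hKc : IsCompact K := isCompact_closedBall _ _
  have hK1 : ball p (S + 1) ⊆ K :=
    (ball_subset_ball (by linarith)).trans ball_subset_closedBall
  have hK2 : ball z (2 * R) ⊆ K := (ball_subset_ball' (by
    rw [dist_comm]
    linarith)).trans ball_subset_closedBall
  have hK3 : ball y r ⊆ K := (ball_subset_ball' (by
    rw [dist_comm]
    linarith)).trans ball_subset_closedBall
  have hK4 : ball p t₀ ⊆ K := (ball_subset_ball (by linarith)).trans hK1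
  have hbd : IsBounded K := isBounded_closedBall
  have hmeq : m (ball y r \ E) = m G := by
    rw [← ENNReal.ofReal_toReal (h.fin _ (isBounded_ball.subset sdiff_subset)).ne,
      ← ENNReal.ofReal_toReal (h.fin G (isBounded_ball.subset inter_subset_right)).ne]
    exact congrArg ENNReal.ofReal hvol
  have hEE' : m (E ∩ K) = m (E' ∩ K) := by
    have e1 : m (E ∩ K) = m G + m ((E ∩ K) \ ball p t₀) := by
      rw [← measure_inter_add_sdiff (E ∩ K) (measurableSet_ball (x := p) (ε := t₀))]
      congr 2
      ext x
      exact ⟨fun hx => ⟨hx.1.1, hx.2⟩, fun hx => ⟨⟨hx.1, hK4 hx.2⟩, hx.2⟩⟩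
    have e2 : m (E' ∩ K) = m ((E ∩ K) \ ball p t₀) + m (ball y r \ E) := by
      rw [← measure_inter_add_sdiff (E' ∩ K) hEm]
      congr 2
      · ext x
        constructor
        · exact fun hx => ⟨⟨hx.2, hx.1.2⟩, hx.1.1.2⟩
        · exact fun hx => ⟨⟨⟨Or.inl hx.1.1, hx.2⟩, hx.1.2⟩, hx.1.1⟩
      · ext x
        constructor
        · exact fun hx => ⟨hx.1.1.1.resolve_left hx.2, hx.2⟩
        · exact fun hx => ⟨⟨⟨Or.inr hx.1, hfar' x hx.1⟩, hK3 hx.1⟩, hx.2⟩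
    rw [e1, e2, hmeq, add_comm]
  have hdiff : m ((E ∆ E') \ K) = 0 := by
    convert measure_empty (μ := m)
    refine eq_empty_of_forall_notMem ?_
    rintro x ⟨hx | hx, hxK⟩
    · exact hx.2 ⟨Or.inl hx.1, fun h' => hxK (hK4 h')⟩
    · exact hxK (hK3 (hx.1.1.resolve_left hx.2))
  obtain ⟨V, hV, hKV, hVfin⟩ := hEfin.exists_open hEm hKc
  have hKfin : Per m E K < ∞ := (totVar_mono hKV).trans_lt hVfin
  have hball : ∀ Ω, IsOpen Ω → K ⊆ Ω → Per m E' K + ENNReal.ofReal (c * W) ≤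
      ENNReal.ofReal (C * w / r + 2 * L) + Per m E Ω := by
    intro Ω hΩ hKΩ
    have f1 : Per m E₁ Ω ≤ ENNReal.ofReal (C * w / r) + Per m E Ω := by
      refine Per_union_ball_le hEm hy hrR hΩ (hK2.trans hKΩ)
        ((totVar_mono hK2).trans_lt hKfin) ?_
      refine (hdef y hy r ⟨hr0, hrR⟩).2.trans (le_of_eq ?_)
      congr 1
      rw [hmeq, ← ENNReal.ofReal_toReal (h.fin G (isBounded_ball.subset inter_subset_right)).ne,
        ← ENNReal.ofReal_mul hC, ← ENNReal.ofReal_div_of_pos hr0]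
      rfl
    have f2 := Per_cut_le hE₁m hΩ (p := p) (S := S) (t₀ := t₀) (η := min (u₀ / κ) (S - t₀))
      (L := L) ((closedBall_subset_closedBall (by linarith)).trans hKΩ) ht₀S
      (lt_min (by positivity) (by linarith)) hL0 (by
        rintro t ⟨ht, ht'⟩
        have g1 : t < t₀ + u₀ / κ := ht'.trans_le (by gcongr; exact min_le_left _ _)
        have g2 : t < t₀ + (S - t₀) := ht'.trans_le (by gcongr; exact min_le_right _ _)
        have g3 : κ * (t - t₀) ≤ u₀ := by
          have : t - t₀ < u₀ / κ := by linarith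
          rw [lt_div_iff₀ hκ0] at this
          linarith
        refine le_trans (measure_mono ?_)
          (h.annulus_le hlen hQ hEm ht₀ ht (hgrow t ⟨ht, by linarith⟩) g3)
        rintro x ⟨hx | hx, hx'⟩
        · exact ⟨hx, hx'⟩
        · exact absurd (closedBall_subset_closedBall (by linarith) hx'.1) (hfar x hx))
    rw [hE₁G] at f2
    have f3 : ENNReal.ofReal (c * W) ≤ Per m G Ω := by
      have := hiso p S (S + 1) g G Ω hGm
        (inter_subset_right.trans (ball_subset_ball ht₀S.le)) hS (by linarith) hg0
        (by linarith) (by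
          have e1 : N ^ Q = m.real (ball p S) := by
            rw [hN, rootMass_pow hQ, univ_inter]
          rw [← e1, hg, div_pow, div_mul_cancel₀ _ (by positivity), hwu]) (by linarith)
        (hK1.trans hKΩ)
      rwa [mul_div_assoc] at this
    calc Per m E' K + ENNReal.ofReal (c * W) ≤ Per m E' Ω + Per m G Ω :=
          add_le_add (totVar_mono hKΩ) f3
      _ ≤ Per m E₁ Ω + 2 * ENNReal.ofReal L := f2
      _ ≤ ENNReal.ofReal (C * w / r) + Per m E Ω + 2 * ENNReal.ofReal L := by gcongr
      _ = _ := by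
          rw [ENNReal.ofReal_add (by positivity) (by positivity),
            ENNReal.ofReal_mul (p := 2) (by norm_num)]
          simp only [ENNReal.ofReal_ofNat]
          ring
  have hmin' := hmin E' K hE'm hKc hdiff hEE'
  have hlt : ENNReal.ofReal (C * w / r + 2 * L) + Per m E K <
      Per m E K + ENNReal.ofReal (c * W) := by
    rw [add_comm]
    refine ENNReal.add_lt_add_left hKfin.ne ?_
    exact (ENNReal.ofReal_lt_ofReal_iff (by positivity)).2 hAB
  have hle : Per m E K + ENNReal.ofReal (c * W) ≤
      ENNReal.ofReal (C * w / r + 2 * L) + Per m E K := by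
    refine (add_le_add_left hmin' _).trans ?_
    have : Per m E' K + ENNReal.ofReal (c * W) - ENNReal.ofReal (C * w / r + 2 * L) ≤
        Per m E K := by
      refine le_of_forall_gt fun d hd => ?_
      obtain ⟨Ω, hΩ, hKΩ, hd'⟩ := exists_open_Per_lt hd
      exact (tsub_le_iff_left.2 (hball Ω hΩ hKΩ)).trans_lt hd'
    exact tsub_le_iff_left.1 this
  exact hlt.not_ge hle

end Core

section Contradiction

variable [MetricSpace X] [MeasurableSpace X] {m : Measure X}

lemma LocDoubling.exists_rootMass_le (h : LocDoubling m) {Q : ℕ} (hQ : 1 ≤ Q) {A : Set X} {p : X}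
    (hp : p ∈ essExt m A) {ε : ℝ} (hε : 0 < ε) :
    ∃ ρ > 0, ∀ S ∈ Ioo 0 ρ, rootMass m Q A p S ≤ ε * rootMass m Q univ p S := by
  obtain ⟨ρ, hρ, hρ'⟩ := h.mem_essExt_iff.1 hp (ε ^ Q) (by positivity)
  refine ⟨ρ, hρ, fun S hS => ?_⟩
  rw [← pow_le_pow_iff_left₀ (rootMass_nonneg _ _ _ _)
    (mul_nonneg hε.le (rootMass_nonneg _ _ _ _)) (by omega : Q ≠ 0), mul_pow, rootMass_pow hQ,
    rootMass_pow hQ, univ_inter]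
  exact hρ' S hS

lemma LocDoubling.exists_real_lt (h : LocDoubling m) {A : Set X} {p : X} (hp : p ∈ essExt m A)
    {η : ℝ} (hη : 0 < η) : ∃ ρ > 0, ∀ S ∈ Ioo 0 ρ, m.real (A ∩ ball p S) < η := by
  have h1 := h.real_pos p one_pos
  obtain ⟨ρ, hρ, hρ'⟩ := h.mem_essExt_iff.1 hp (η / (2 * m.real (ball p 1))) (by positivity)
  refine ⟨min ρ 1, lt_min hρ one_pos, fun S hS => ?_⟩
  calc m.real (A ∩ ball p S) ≤ η / (2 * m.real (ball p 1)) * m.real (ball p S) :=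
        hρ' S ⟨hS.1, hS.2.trans_le (min_le_left _ _)⟩
    _ ≤ η / (2 * m.real (ball p 1)) * m.real (ball p 1) := by
        have := h.real_mono (ball_subset_ball (x := p) (hS.2.le.trans (min_le_right _ _)))
          isBounded_ball
        gcongr
    _ = η / 2 := by field_simp
    _ < η := half_lt_self hη

lemma LocDoubling.rootMass_univ_pos (h : LocDoubling m) (Q : ℕ) (p : X) {S : ℝ} (hS : 0 < S) :
    0 < rootMass m Q univ p S := by
  unfold rootMass
  rw [univ_inter]
  exact Real.rpow_pos_of_pos (h.real_pos p hS) _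

lemma rootMass_pos {A : Set X} {p : X} {S : ℝ} (Q : ℕ) (hA : 0 < m.real (A ∩ ball p S)) :
    0 < rootMass m Q A p S :=
  Real.rpow_pos_of_pos hA _

variable [BorelSpace X]

lemma LocDoubling.exists_radius_eq [TopologicalSpace.SeparableSpace X] (h : LocDoubling m)
    (hlen : IsLengthSpace X) {A : Set X} (hA : MeasurableSet A) (y : X) {s t v : ℝ} (hs : 0 < s)
    (hst : s ≤ t) (h1 : m.real (A ∩ ball y s) ≤ v) (h2 : v ≤ m.real (A ∩ ball y t)) :
    ∃ r ∈ Icc s t, m.real (A ∩ ball y r) = v :=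
  intermediate_value_Icc hst
    ((h.continuousOn_inter_ball hlen hA y).mono fun _ hx => hs.trans_le hx.1) ⟨h1, h2⟩

lemma VolConstMin.compl {E : Set X} (hE : VolConstMin m E)
    (h : LocDoubling m) : VolConstMin m Eᶜ := by
  obtain ⟨hEm, hfin, hmin⟩ := hE
  refine ⟨hEm.compl, fun x => ?_, fun F K hF hK h1 h2 => ?_⟩
  · obtain ⟨r, hr, hr'⟩ := hfin x
    exact ⟨r, hr, by rwa [Per_compl]⟩
  · rw [Per_compl, ← Per_compl F]
    have hKm := hK.measurableSet
    have hKf := (h.fin K hK.isBounded).ne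
    have key : ∀ A : Set X, MeasurableSet A → m (Aᶜ ∩ K) = m K - m (A ∩ K) := by
      intro A hA
      rw [show Aᶜ ∩ K = K \ (A ∩ K) by ext x; simp; tauto,
        measure_sdiff inter_subset_right (hA.inter hKm).nullMeasurableSet
          (measure_ne_top_of_subset inter_subset_right hKf)]
    refine hmin Fᶜ K hF.compl hK ?_ ?_
    · convert h1 using 3
      ext x
      simp only [Set.mem_symmDiff, mem_compl_iff]
      tauto
    · rw [key F hF, ← h2, key E hEm, ENNReal.sub_sub_cancel hKf (measure_mono inter_subset_right)]

variable [ProperSpace X]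

/-- A volume-constrained minimizer cannot have, near a point `p` of density zero, more volume than
its complement has near a point `y` where balls can be added. -/
lemma VolConstMin.false_of_le {E : Set X} (hE : VolConstMin m E) (h : LocDoubling m)
    (hlen : IsLengthSpace X) {c : ℝ} (hc : 0 < c) {Q : ℕ} (hQ : 1 ≤ Q) (hiso : SmallIso m c Q)
    {p y z : X} {R C r₁ : ℝ} (hC : 0 ≤ C) (hdef : DeformIneq m E z R C) (hy : y ∈ ball z R)
    (hr₁0 : 0 < r₁) (hr₁R : r₁ < R) (hr₁ : r₁ < dist p y) (ha : 0 < m.real (Eᶜ ∩ ball y r₁))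
    (hp : p ∈ essExt m E) (hpos : ∀ t, 0 < t → 0 < m.real (E ∩ ball p t)) {t₁ : ℝ} (ht₁ : 0 < t₁)
    (hle : ∀ t ∈ Ioo 0 t₁, m.real (Eᶜ ∩ ball y t) ≤ m.real (E ∩ ball p t)) : False := by
  obtain ⟨ε, hε, hex⟩ := hE.not_exchange h hlen hc hQ hiso hC hdef hy hr₁R hr₁
  obtain ⟨ρ₁, hρ₁, hroot⟩ := h.exists_rootMass_le hQ hp (show 0 < ε / 4 by positivity)
  obtain ⟨ρ₂, hρ₂, hsmall⟩ := h.exists_real_lt hp ha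
  obtain ⟨S, hS, hS'⟩ := exists_between
    (show 0 < min (min ε ρ₁) (min (min ρ₂ t₁) r₁) by simp [*])
  simp only [lt_min_iff] at hS'
  obtain ⟨⟨hSε, hSρ₁⟩, ⟨hSρ₂, hSt₁⟩, hSr₁⟩ := hS'
  have hN := h.rootMass_univ_pos Q p hS
  have hSroot := hroot S ⟨hS, hSρ₁⟩
  obtain ⟨t₀, ht₀, hgrow⟩ := exists_forall_growth_lt (g := rootMass m Q E p) (a := S / 2) (b := S)
    (κ := ε * rootMass m Q univ p S / S) (by linarith)
    ((h.continuousOn_rootMass hlen Q hE.1 p).mono fun x hx => (half_pos hS).trans_le hx.1) (by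
      have e : ε * rootMass m Q univ p S / S * (S - S / 2) = ε * rootMass m Q univ p S / 2 := by
        field_simp
        ring
      rw [e]
      have := rootMass_nonneg (m := m) Q E p (S / 2)
      nlinarith)
  have ht₀0 : 0 < t₀ := (half_pos hS).trans_le ht₀.1
  obtain ⟨r, hr, hr'⟩ := h.exists_radius_eq hlen hE.1.compl y ht₀0 (ht₀.2.le.trans hSr₁.le)
    (hle t₀ ⟨ht₀0, ht₀.2.trans hSt₁⟩)
    ((h.real_mono (inter_subset_inter_right _ (ball_subset_ball ht₀.2.le))
      (isBounded_ball.subset inter_subset_right)).trans (hsmall S ⟨hS, hSρ₂⟩).le)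
  rw [inter_comm, ← Set.sdiff_eq] at hr'
  refine hex S t₀ r hS hSε ht₀.1 ht₀.2 hr.1 hr.2 (rootMass_pos Q (hpos t₀ ht₀0))
    (hSroot.trans (by nlinarith)) (fun t ht => (hgrow t ht).le) hr'

/-- Two-point version of `VolConstMin.not_exchange` at a scale where volumes balance. -/
lemma LocDoubling.exists_balanced_scale (h : LocDoubling m) (hlen : IsLengthSpace X) {Q : ℕ}
    (hQ : 1 ≤ Q) {E F : Set X} (hE : MeasurableSet E) (hF : MeasurableSet F) {p q : X} {ε S : ℝ}
    (hε : 0 < ε) (hS : 0 < S) (hp : rootMass m Q E p S ≤ ε / 4 * rootMass m Q univ p S)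
    (hq : rootMass m Q F q S ≤ ε / 4 * rootMass m Q univ q S)
    (heq : m.real (E ∩ ball p S) = m.real (F ∩ ball q S)) :
    ∃ t₀ ∈ Ico (S / 2) S,
      (m.real (F ∩ ball q t₀) ≤ m.real (E ∩ ball p t₀) ∧
        ∀ t ∈ Ioc t₀ S, rootMass m Q E p t - rootMass m Q E p t₀ ≤
          ε * rootMass m Q univ p S / S * (t - t₀)) ∨
      (m.real (E ∩ ball p t₀) ≤ m.real (F ∩ ball q t₀) ∧
        ∀ t ∈ Ioc t₀ S, rootMass m Q F q t - rootMass m Q F q t₀ ≤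
          ε * rootMass m Q univ q S / S * (t - t₀)) := by
  set u := rootMass m Q E p with hu
  set v := rootMass m Q F q with hv
  have huv : u S = v S := by rw [hu, hv, rootMass, rootMass, heq]
  set N := min (rootMass m Q univ p S) (rootMass m Q univ q S) with hN
  have hN0 : 0 < N := lt_min (h.rootMass_univ_pos Q p hS) (h.rootMass_univ_pos Q q hS)
  have hle : max (u S) (v S) ≤ ε / 4 * N := by
    rw [hN, mul_min_of_nonneg _ _ (by positivity), huv, max_self]
    exact le_min (huv ▸ hp) hq
  have hsub : Icc (S / 2) S ⊆ Ioi 0 := fun x hx => (half_pos hS).trans_le hx.1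
  obtain ⟨t₀, ht₀, hgrow⟩ := exists_forall_growth_lt (g := fun t => max (u t) (v t)) (a := S / 2)
    (b := S) (κ := ε * N / S) (by linarith)
    (fun x hx => ((h.continuousOn_rootMass hlen Q hE p).mono hsub x hx).max
      ((h.continuousOn_rootMass hlen Q hF q).mono hsub x hx)) (by
      have e : ε * N / S * (S - S / 2) = ε * N / 2 := by
        field_simp
        ring
      rw [e]
      have : 0 ≤ max (u (S / 2)) (v (S / 2)) := le_max_of_le_left (rootMass_nonneg _ _ _ _)
      nlinarith)
  have hroot : ∀ a b : ℝ, 0 ≤ a → 0 ≤ b → a ≤ b → a ^ Q ≤ b ^ Q := fun a b ha _ hab => by gcongr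
  refine ⟨t₀, ht₀, ?_⟩
  rcases le_total (v t₀) (u t₀) with hle' | hle'
  · left
    constructor
    · rw [← rootMass_pow hQ F, ← rootMass_pow hQ E]
      exact hroot _ _ (rootMass_nonneg _ _ _ _) (rootMass_nonneg _ _ _ _) hle'
    · intro t ht
      have h1 := (hgrow t ht).le
      simp only [max_eq_left hle'] at h1
      have h2 : 0 ≤ t - t₀ := sub_nonneg.2 ht.1.le
      calc u t - u t₀ ≤ max (u t) (v t) - u t₀ := by gcongr; exact le_max_left _ _
        _ ≤ ε * N / S * (t - t₀) := h1
        _ ≤ _ := by gcongr; exact min_le_left _ _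
  · right
    constructor
    · rw [← rootMass_pow hQ F, ← rootMass_pow hQ E]
      exact hroot _ _ (rootMass_nonneg _ _ _ _) (rootMass_nonneg _ _ _ _) hle'
    · intro t ht
      have h1 := (hgrow t ht).le
      simp only [max_eq_right hle'] at h1
      have h2 : 0 ≤ t - t₀ := sub_nonneg.2 ht.1.le
      calc v t - v t₀ ≤ max (u t) (v t) - v t₀ := by gcongr; exact le_max_right _ _
        _ ≤ ε * N / S * (t - t₀) := h1
        _ ≤ _ := by gcongr; exact min_le_right _ _

lemma LocDoubling.exists_real_eq (h : LocDoubling m) (hlen : IsLengthSpace X) {E F : Set X}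
    (hE : MeasurableSet E) (hF : MeasurableSet F) {p q : X} {δ : ℝ}
    (h1 : ∃ t ∈ Ioo 0 δ, m.real (E ∩ ball p t) ≤ m.real (F ∩ ball q t))
    (h2 : ∃ t ∈ Ioo 0 δ, m.real (F ∩ ball q t) ≤ m.real (E ∩ ball p t)) :
    ∃ S ∈ Ioo 0 δ, m.real (E ∩ ball p S) = m.real (F ∩ ball q S) := by
  obtain ⟨s, hs, hs'⟩ := h1
  obtain ⟨t, ht, ht'⟩ := h2
  exact isPreconnected_Ioo.intermediate_value₂ hs ht
    ((h.continuousOn_inter_ball hlen hE p).mono fun _ hx => hx.1)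
    ((h.continuousOn_inter_ball hlen hF q).mono fun _ hx => hx.1) hs' ht'

end Contradiction

section Regularity

variable [MetricSpace X] [MeasurableSpace X] {m : Measure X}

/-- The open set of points near which `A` has measure zero. -/
def nullNhds (m : Measure X) (A : Set X) : Set X := {x | ∃ r > 0, m (A ∩ ball x r) = 0}

lemma isOpen_nullNhds (A : Set X) : IsOpen (nullNhds m A) := by
  refine Metric.isOpen_iff.2 fun x hx => ?_
  obtain ⟨r, hr, hr'⟩ := hx
  refine ⟨r, hr, fun y hy => ⟨r - dist y x, sub_pos.2 hy, measure_mono_null ?_ hr'⟩⟩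
  exact inter_subset_inter_right _ (ball_subset_ball' (by linarith))

lemma nullNhds_subset_essExt (A : Set X) : nullNhds m A ⊆ essExt m A := by
  rintro x ⟨r, hr, hr'⟩
  refine Tendsto.congr' ?_ tendsto_const_nhds
  filter_upwards [Ioo_mem_nhdsGT hr] with s hs
  rw [measure_mono_null (inter_subset_inter_right A (ball_subset_ball hs.2.le)) hr',
    ENNReal.zero_div]

lemma LocDoubling.real_pos_of_notMem_nullNhds (h : LocDoubling m) {A : Set X} {x : X}
    (hx : x ∉ nullNhds m A) {r : ℝ} (hr : 0 < r) : 0 < m.real (A ∩ ball x r) :=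
  ENNReal.toReal_pos (fun h' => hx ⟨r, hr, h'⟩)
    (h.fin _ (isBounded_ball.subset inter_subset_right)).ne

lemma LocDoubling.essExt_compl (h : LocDoubling m) {E : Set X} (hE : MeasurableSet E) :
    essExt m Eᶜ = essInt m E :=
  ext fun _ => (h.mem_essInt_iff hE).symm

variable [BorelSpace X] [ProperSpace X]

lemma VolConstMin.false_of_nullNhds_nonempty {E : Set X} (hE : VolConstMin m E)
    (h : LocDoubling m) (hlen : IsLengthSpace X) {c : ℝ} (hc : 0 < c) {Q : ℕ} (hQ : 1 ≤ Q)
    (hiso : SmallIso m c Q) (hdef : DeformationProperty m) {p : X} (hp : p ∈ essExt m E)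
    (hpE : p ∉ nullNhds m E) (hne : (nullNhds m Eᶜ).Nonempty) : False := by
  set O := nullNhds m Eᶜ with hO
  have hOo : IsOpen O := isOpen_nullNhds _
  have hpO : p ∉ O := fun hpO => by
    have := (h.mem_essInt_iff hE.1).2 (nullNhds_subset_essExt _ hpO)
    exact (essInt_inter_essExt (m := m) E).le ⟨this, hp⟩
  have := hlen.preconnectedSpace
  obtain ⟨z, hz⟩ : (frontier O).Nonempty := by
    rw [nonempty_iff_ne_empty]
    intro hf
    rcases isClopen_iff.1 (isClopen_iff_frontier_eq_empty.2 hf) with h' | h'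
    · exact hne.ne_empty h'
    · exact hpO (h' ▸ mem_univ p)
  have hzO : z ∉ O := fun h' => (hOo.frontier_eq ▸ hz : z ∈ closure O \ O).2 h'
  obtain ⟨R, hR0, -, C, hC, hD⟩ := hdef E hE.1 hE.2.1 z
  obtain ⟨y, hyO, hyz⟩ := Metric.mem_closure_iff.1 (frontier_subset_closure hz) R hR0
  set T := {r : ℝ | m (Eᶜ ∩ ball y r) = 0} with hT
  have hTmono : ∀ r ∈ T, ∀ s ≤ r, s ∈ T := fun r hr s hs =>
    measure_mono_null (inter_subset_inter_right _ (ball_subset_ball hs)) hr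
  have hTb : ∀ r ∈ T, r ≤ dist z y := by
    intro r hr
    by_contra! hlt
    refine hzO ⟨r - dist z y, sub_pos.2 hlt, measure_mono_null ?_ hr⟩
    exact inter_subset_inter_right _ (ball_subset_ball' (by linarith))
  have hTbdd : BddAbove T := ⟨_, hTb⟩
  obtain ⟨r₀, hr₀, hr₀T⟩ := hyO
  set R₀ := sSup T with hR₀
  have hR₀0 : 0 < R₀ := hr₀.trans_le (le_csSup hTbdd hr₀T)
  have hR₀R : R₀ < R := (csSup_le ⟨r₀, hr₀T⟩ hTb).trans_lt hyz
  have hR₀T : m (Eᶜ ∩ ball y R₀) = 0 := by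
    obtain ⟨s, -, hs, hsT⟩ := exists_seq_tendsto_sSup ⟨r₀, hr₀T⟩ hTbdd
    have hc := (h.continuousOn_inter_ball hlen hE.1.compl y).continuousAt (Ioi_mem_nhds hR₀0)
    have e1 : m.real (Eᶜ ∩ ball y R₀) = 0 := tendsto_nhds_unique (hc.tendsto.comp hs)
      (tendsto_const_nhds.congr fun n => by
        have : m (Eᶜ ∩ ball y (s n)) = 0 := hsT n
        simp [Measure.real, this])
    exact (measureReal_eq_zero_iff (h.fin _ (isBounded_ball.subset inter_subset_right)).ne).1 e1
  have hR₀p : R₀ < dist p y := h.lt_dist_of_null hlen hR₀0 hR₀T (by rwa [compl_compl])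
  obtain ⟨r₁, hr₁, hr₁'⟩ := exists_between (lt_min hR₀R hR₀p)
  refine hE.false_of_le h hlen hc hQ hiso hC hD (by rwa [mem_ball, dist_comm])
    (hR₀0.trans hr₁) (hr₁'.trans_le (min_le_left _ _)) (hr₁'.trans_le (min_le_right _ _)) ?_ hp
    (fun t ht => h.real_pos_of_notMem_nullNhds hpE ht) hR₀0 fun t ht => ?_
  · refine ENNReal.toReal_pos (fun h' => ?_)
      (h.fin _ (isBounded_ball.subset inter_subset_right)).ne
    exact (le_csSup hTbdd h').not_gt hr₁
  · have : m (Eᶜ ∩ ball y t) = 0 := hTmono R₀ hR₀T t ht.2.le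
    simp [Measure.real, this]

lemma VolConstMin.false_of_nullNhds_eq_empty {E : Set X} (hE : VolConstMin m E)
    (h : LocDoubling m) (hlen : IsLengthSpace X) {c : ℝ} (hc : 0 < c) {Q : ℕ} (hQ : 1 ≤ Q)
    (hiso : SmallIso m c Q) (hdef : DeformationProperty m) {p q : X} (hp : p ∈ essExt m E)
    (hpE : p ∉ nullNhds m E) (hq : q ∈ essInt m E) (hqE : q ∉ nullNhds m Eᶜ) : False := by
  have hE' := hE.compl h
  have hq' := (h.mem_essInt_iff hE.1).1 hq
  have hpq : p ≠ q := by
    rintro rfl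
    exact (essInt_inter_essExt (m := m) E).le ⟨hq, hp⟩
  have hd : 0 < dist p q := dist_pos.2 hpq
  have hposp : ∀ t, 0 < t → 0 < m.real (E ∩ ball p t) :=
    fun t ht => h.real_pos_of_notMem_nullNhds hpE ht
  have hposq : ∀ t, 0 < t → 0 < m.real (Eᶜ ∩ ball q t) :=
    fun t ht => h.real_pos_of_notMem_nullNhds hqE ht
  obtain ⟨R, hR0, -, C, hC, hD⟩ := hdef E hE.1 hE.2.1 q
  obtain ⟨R', hR'0, -, C', hC', hD'⟩ := hdef Eᶜ hE'.1 hE'.2.1 p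
  obtain ⟨r₁, hr₁0, hr₁⟩ := exists_between (lt_min (lt_min hR0 hR'0) hd)
  simp only [lt_min_iff] at hr₁
  obtain ⟨⟨hr₁R, hr₁R'⟩, hr₁d⟩ := hr₁
  have hqR : q ∈ ball q R := mem_ball_self hR0
  have hpR' : p ∈ ball p R' := mem_ball_self hR'0
  have hd' : r₁ < dist q p := by rwa [dist_comm]
  have hscale : ∀ δ > 0, ∃ S ∈ Ioo 0 δ, m.real (E ∩ ball p S) = m.real (Eᶜ ∩ ball q S) := by
    intro δ hδ
    refine h.exists_real_eq hlen hE.1 hE.1.compl ?_ ?_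
    · by_contra! h'
      exact hE.false_of_le h hlen hc hQ hiso hC hD hqR hr₁0 hr₁R hr₁d (hposq _ hr₁0) hp hposp hδ
        fun t ht => (h' t ht).le
    · by_contra! h'
      refine hE'.false_of_le h hlen hc hQ hiso hC' hD' hpR' hr₁0 hr₁R' hd' ?_ hq' hposq hδ
        fun t ht => ?_
      · rw [compl_compl]
        exact hposp _ hr₁0
      · rw [compl_compl]
        exact (h' t ht).le
  obtain ⟨ε₁, hε₁, hex₁⟩ := hE.not_exchange h hlen hc hQ hiso hC hD hqR hr₁R hr₁d
  obtain ⟨ε₂, hε₂, hex₂⟩ := hE'.not_exchange h hlen hc hQ hiso hC' hD' hpR' hr₁R' hd'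
  set ε := min ε₁ ε₂ with hε
  have hε0 : 0 < ε := lt_min hε₁ hε₂
  have hεl : ε ≤ ε₁ := min_le_left _ _
  have hεr : ε ≤ ε₂ := min_le_right _ _
  obtain ⟨ρ₁, hρ₁, hroot₁⟩ := h.exists_rootMass_le hQ hp (show 0 < ε / 4 by positivity)
  obtain ⟨ρ₂, hρ₂, hroot₂⟩ := h.exists_rootMass_le hQ hq' (show 0 < ε / 4 by positivity)
  obtain ⟨S, ⟨hS, hS'⟩, heq⟩ := hscale (min (min ε ρ₁) (min ρ₂ r₁)) (by simp [*])
  simp only [lt_min_iff] at hS'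
  obtain ⟨⟨hSε, hSρ₁⟩, hSρ₂, hSr₁⟩ := hS'
  have hNp := h.rootMass_univ_pos Q p hS
  have hNq := h.rootMass_univ_pos Q q hS
  obtain ⟨t₀, ht₀, ⟨hle, hgrow⟩ | ⟨hle, hgrow⟩⟩ := h.exists_balanced_scale hlen hQ hE.1 hE.1.compl
    hε0 hS (hroot₁ S ⟨hS, hSρ₁⟩) (hroot₂ S ⟨hS, hSρ₂⟩) heq
  · have ht₀0 : 0 < t₀ := (half_pos hS).trans_le ht₀.1
    obtain ⟨r, hr, hr'⟩ := h.exists_radius_eq hlen hE.1.compl q ht₀0 ht₀.2.le hle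
      ((h.real_mono (inter_subset_inter_right _ (ball_subset_ball ht₀.2.le))
        (isBounded_ball.subset inter_subset_right)).trans heq.le)
    rw [inter_comm, ← Set.sdiff_eq] at hr'
    refine hex₁ S t₀ r hS (hSε.trans_le hεl) ht₀.1 ht₀.2 hr.1 (hr.2.trans hSr₁.le)
      (rootMass_pos Q (hposp t₀ ht₀0)) ((hroot₁ S ⟨hS, hSρ₁⟩).trans (by nlinarith))
      (fun t ht => (hgrow t ht).trans ?_) hr'
    have := sub_nonneg.2 ht.1.le
    gcongr
  · have ht₀0 : 0 < t₀ := (half_pos hS).trans_le ht₀.1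
    obtain ⟨r, hr, hr'⟩ := h.exists_radius_eq hlen hE.1 p ht₀0 ht₀.2.le hle
      ((h.real_mono (inter_subset_inter_right _ (ball_subset_ball ht₀.2.le))
        (isBounded_ball.subset inter_subset_right)).trans heq.ge)
    rw [inter_comm, ← compl_compl E, ← Set.sdiff_eq, compl_compl] at hr'
    refine hex₂ S t₀ r hS (hSε.trans_le hεr) ht₀.1 ht₀.2 hr.1 (hr.2.trans hSr₁.le)
      (rootMass_pos Q (hposq t₀ ht₀0)) ((hroot₂ S ⟨hS, hSρ₂⟩).trans (by nlinarith))
      (fun t ht => (hgrow t ht).trans ?_) hr'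
    have := sub_nonneg.2 ht.1.le
    gcongr

lemma VolConstMin.isOpen_essExt {E : Set X} (hE : VolConstMin m E)
    (h : LocDoubling m) (hlen : IsLengthSpace X) {c : ℝ} (hc : 0 < c) {Q : ℕ} (hQ : 1 ≤ Q)
    (hiso : SmallIso m c Q) (hdef : DeformationProperty m) : IsOpen (essExt m E) := by
  suffices essExt m E = nullNhds m E from this ▸ isOpen_nullNhds E
  refine subset_antisymm (fun p hp => ?_) (nullNhds_subset_essExt E)
  by_contra hpE
  rcases (essInt m E).eq_empty_or_nonempty with h0 | ⟨q, hq⟩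
  · refine hpE ⟨1, one_pos, measure_mono_null inter_subset_left ?_⟩
    simpa [h0] using h.measure_diff_essInt hE.1
  · by_cases hne : q ∈ nullNhds m Eᶜ
    · exact hE.false_of_nullNhds_nonempty h hlen hc hQ hiso hdef hp hpE ⟨q, hne⟩
    · exact hE.false_of_nullNhds_eq_empty h hlen hc hQ hiso hdef hp hpE hq hne

lemma LocDoubling.compl_closure_essInt_subset (h : LocDoubling m) {E : Set X}
    (hE : MeasurableSet E) : (closure (essInt m E))ᶜ ⊆ essExt m E := by
  intro x hx
  obtain ⟨r, hr, hr'⟩ := Metric.isOpen_iff.1 isClosed_closure.isOpen_compl x hx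
  refine nullNhds_subset_essExt E ⟨r, hr, measure_mono_null ?_ (h.measure_diff_essInt hE)⟩
  exact fun y hy => ⟨hy.1, fun hy' => hr' hy.2 (subset_closure hy')⟩

lemma LocDoubling.frontier_essInt (h : LocDoubling m) {E : Set X} (hE : MeasurableSet E)
    (h1 : IsOpen (essInt m E)) (h0 : IsOpen (essExt m E)) :
    frontier (essInt m E) = essBdry m E := by
  have hdisj : Disjoint (essInt m E) (essExt m E) :=
    disjoint_iff_inter_eq_empty.2 (essInt_inter_essExt E)
  rw [h1.frontier_eq]
  ext x
  simp only [essBdry, mem_compl_iff, mem_union, not_or]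
  constructor
  · exact fun hx => ⟨hx.2, fun hx' => disjoint_left.1 (hdisj.closure_left h0) hx.1 hx'⟩
  · refine fun hx => ⟨?_, hx.1⟩
    by_contra h'
    exact hx.2 (h.compl_closure_essInt_subset hE h')

end Regularity

/-- **Topological regularity of volume-constrained minimizers** (Theorem 1.1):
in a length PI space with the deformation property, the essential interior and
essential exterior of a volume-constrained minimizer equal their topological
interiors; in particular they are open and their topological boundaries both
coincide with the essential boundary. -/
theorem topological_regularity_of_volume_constrained_minimizers
    {X : Type*} [MetricSpace X] [CompleteSpace X] [TopologicalSpace.SeparableSpace X]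
    [MeasurableSpace X] [BorelSpace X] (m : Measure X)
    (hbf : BoundedlyFinite m) (hPI : IsPIspace m) (hlen : IsLengthSpace X)
    (hdef : DeformationProperty m) (E : Set X) (hE : VolConstMin m E) :
    essInt m E = interior (essInt m E) ∧ essExt m E = interior (essExt m E) ∧
    IsOpen (essInt m E) ∧ IsOpen (essExt m E) ∧
    frontier (essInt m E) = essBdry m E ∧ frontier (essExt m E) = essBdry m E := by
  rcases eq_or_ne m 0 with rfl | hm
  · have h0 : essExt (0 : Measure X) E = univ := eq_univ_of_forall fun x =>
      nullNhds_subset_essExt E ⟨1, one_pos, by simp⟩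
    have h1 : essInt (0 : Measure X) E = ∅ := by
      have := essInt_inter_essExt (m := (0 : Measure X)) E
      rwa [h0, inter_univ] at this
    simp [essBdry, h0, h1]
  obtain ⟨⟨C_D, -, hD⟩, lam, hlam, C_P, hC, hP⟩ := hPI
  have h : LocDoubling m := LocDoubling.of_ne_zero hbf hD hm
  have : ProperSpace X := h.properSpace
  obtain ⟨c, hc, Q, hQ, hiso⟩ := hP.exists_smallIso h hlam hC
  have hE' := hE.compl h
  have h0 : IsOpen (essExt m E) := hE.isOpen_essExt h hlen hc hQ hiso hdef
  have h1 : IsOpen (essInt m E) := by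
    rw [← h.essExt_compl hE.1]
    exact hE'.isOpen_essExt h hlen hc hQ hiso hdef
  refine ⟨h1.interior_eq.symm, h0.interior_eq.symm, h1, h0, h.frontier_essInt hE.1 h1 h0, ?_⟩
  have e : essInt m Eᶜ = essExt m E := by
    rw [← h.essExt_compl hE'.1, compl_compl]
  have e' : essBdry m Eᶜ = essBdry m E := by
    rw [essBdry, essBdry, e, h.essExt_compl hE.1, union_comm]
  rw [← e, ← e']
  exact h.frontier_essInt hE'.1 (e ▸ h0) (h.essExt_compl hE.1 ▸ h1)

end
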